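/- Define Φ(t) := ∑_{n=1}^∞ (2n⁴π²e^{9t} − 3n²πe^{5t}) e^{−n²π e^{4t}} for t ≥ 0 and b̂_n := ∫_0^∞ t^{2n} Φ(t) dt for n ∈ ℕ₀. If the Riemann Hypothesis is true, then for every q ∈ (0,1) the power series ∑_{n=0}^∞ C_n^∞(q) · (n! b̂_n/(2n)!) · z^n defines an entire function belonging to 𝓝̄_∞(q); in particular, the sequence {n! b̂_n/(2n)!}_{n=0}^∞ is log-concave: (n! b̂_n/(2n)!)² ≥ ((n−1)! b̂_{n−1}/(2n−2)!)·((n+1)! b̂_{n+1}/(2n+2)!) for all n ≥ 1. -/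

import Mathlib

open Polynomial Filter

open scoped Classical

noncomputable section

/-- `R_n(q;z) = ∏_{j=1}^n (1 + q^{j-1} z)`, the generating polynomial of the
q-binomial coefficients. -/
def Rpoly (n : ℕ) (q : ℝ) : Polynomial ℝ :=
  ∏ j ∈ Finset.range n, (1 + Polynomial.C (q ^ j) * Polynomial.X)

/-- The q-binomial coefficient `C_k^n(q)`. -/
def qBinom (n k : ℕ) (q : ℝ) : ℝ := (Rpoly n q).coeff k

/-- The weighted Hadamard product `F *_q^n G`: if `F = ∑ C_k^n(q) a_k z^k` and
`G = ∑ C_k^n(q) b_k z^k`, then `F *_q^n G = ∑ C_k^n(q) a_k b_k z^k`. -/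
def qHadamard (n : ℕ) (q : ℝ) (F G : Polynomial ℝ) : Polynomial ℝ :=
  ∑ k ∈ Finset.range (n + 1),
    Polynomial.C (F.coeff k * G.coeff k / qBinom n k q) * Polynomial.X ^ k

/-- All zeros of the real polynomial `F` are real (it splits over `ℝ`). -/
def RealRooted (F : Polynomial ℝ) : Prop :=
  F = 0 ∨ F.roots.card = F.natDegree

/-- All real roots of `F` are nonpositive. -/
def OnlyNonposRoots (F : Polynomial ℝ) : Prop := ∀ x ∈ F.roots, x ≤ 0

/-- The multiset `s` (of zeros, with multiplicity) is logarithmically q-separated. -/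
def LogSep (q : ℝ) (s : Multiset ℝ) : Prop :=
  (∀ x ∈ s, x ≠ 0 → 2 ≤ s.count x → (1 : ℝ) ≤ q) ∧
  (∀ x ∈ s, ∀ y ∈ s, ((y < x ∧ x < 0) ∨ (0 < x ∧ x < y)) → x / y ≤ q)

/-- The multiset `s` (of zeros, with multiplicity) is strictly logarithmically
q-separated. -/
def StrictLogSep (q : ℝ) (s : Multiset ℝ) : Prop :=
  (∀ x ∈ s, x ≠ 0 → 2 ≤ s.count x → (1 : ℝ) < q) ∧
  (∀ x ∈ s, ∀ y ∈ s, ((y < x ∧ x < 0) ∨ (0 < x ∧ x < y)) → x / y < q)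

/-- The class `𝓡̄_n(q)`. -/
def memRbar (n : ℕ) (q : ℝ) (F : Polynomial ℝ) : Prop :=
  F.natDegree ≤ n ∧ RealRooted F ∧ LogSep q F.roots

/-- The class `𝓡_n(q)`. -/
def memR (n : ℕ) (q : ℝ) (F : Polynomial ℝ) : Prop :=
  F.natDegree ≤ n ∧ RealRooted F ∧ StrictLogSep q F.roots

/-- The class `𝓝̄_n(q)`. -/
def memNbar (n : ℕ) (q : ℝ) (F : Polynomial ℝ) : Prop :=
  memRbar n q F ∧ OnlyNonposRoots F

/-- The class `𝓝_n(q)`. -/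
def memN (n : ℕ) (q : ℝ) (F : Polynomial ℝ) : Prop :=
  memR n q F ∧ OnlyNonposRoots F

/-- `F ≼ G` : both have only real zeros and `F'G - FG' ≤ 0` on `ℝ`. -/
def Prec (F G : Polynomial ℝ) : Prop :=
  RealRooted F ∧ RealRooted G ∧
    ∀ x : ℝ, (Polynomial.derivative F * G - F * Polynomial.derivative G).eval x ≤ 0

/-- `F ≺ G` : `F ≼ G` and no common zeros. -/
def PrecS (F G : Polynomial ℝ) : Prop :=
  Prec F G ∧ ∀ x : ℝ, ¬ (F.eval x = 0 ∧ G.eval x = 0)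

/-- `F ≺₀ G` : `F ≼ G` and no common zeros except possibly at the origin. -/
def Prec0 (F G : Polynomial ℝ) : Prop :=
  Prec F G ∧ ∀ x : ℝ, x ≠ 0 → ¬ (F.eval x = 0 ∧ G.eval x = 0)

/-- `F ⋎ G` : `G ≼ zF`. -/
def Veebar (F G : Polynomial ℝ) : Prop := Prec G (Polynomial.X * F)

/-- `F ∨ G` : `F ⋎ G` and no common zeros except possibly at the origin. -/
def VeeS (F G : Polynomial ℝ) : Prop :=
  Veebar F G ∧ ∀ x : ℝ, x ≠ 0 → ¬ (F.eval x = 0 ∧ G.eval x = 0)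

/-- `F ⊴ G` : `F ⋎ G` for polynomials with only nonpositive zeros. -/
def TriLE (F G : Polynomial ℝ) : Prop :=
  OnlyNonposRoots F ∧ OnlyNonposRoots G ∧ Veebar F G

/-- `F ◁ G` : `F ∨ G` for polynomials with only nonpositive zeros. -/
def TriLT (F G : Polynomial ℝ) : Prop :=
  OnlyNonposRoots F ∧ OnlyNonposRoots G ∧ VeeS F G

/-- `F` is extremal (in `𝓡̄_n(q)` or `𝓝̄_n(q)`): `F(z) = c · R_n(q; a z)` for
nonzero reals `a`, `c`. -/
def Extremal (n : ℕ) (q : ℝ) (F : Polynomial ℝ) : Prop :=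
  ∃ a c : ℝ, a ≠ 0 ∧ c ≠ 0 ∧
    F = Polynomial.C c * (Rpoly n q).comp (Polynomial.C a * Polynomial.X)

/-- The q-difference operator `Δ_{q,n}`. -/
def qDelta (q : ℝ) (n : ℕ) (F : Polynomial ℝ) : Polynomial ℝ :=
  if q = 1 then Polynomial.C ((n : ℝ)⁻¹) * Polynomial.derivative F
  else Polynomial.C (q ^ (n - 1) - q⁻¹)⁻¹ *
    (F - F.comp (Polynomial.C q⁻¹ * Polynomial.X)).divX

/-- The operator `Δ*_{q,n}`. -/
def qDeltaStar (q : ℝ) (n : ℕ) (F : Polynomial ℝ) : Polynomial ℝ :=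
  if q = 1 then F - Polynomial.C ((n : ℝ)⁻¹) * (Polynomial.X * Polynomial.derivative F)
  else Polynomial.C (q⁻¹ ^ n - 1)⁻¹ *
    (Polynomial.C (q⁻¹ ^ n) * F - F.comp (Polynomial.C q⁻¹ * Polynomial.X))

/-- The sequence `a_0, …, a_n` is strictly log-concave (`𝓛𝓒_n`):
`a_k² > a_{k-1} a_{k+1}` for every `k` for which there are `l ≤ k` and `m ≥ k`
with `a_l ≠ 0 ≠ a_m` (with the convention `a_{-1} = 0`). -/
def LCcond (n : ℕ) (a : ℕ → ℝ) : Prop :=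
  ∀ k ≤ n, (∃ l, l ≤ k ∧ a l ≠ 0) → (∃ m, k ≤ m ∧ m ≤ n ∧ a m ≠ 0) →
    (if k = 0 then (0 : ℝ) else a (k - 1)) * a (k + 1) < a k ^ 2

/-- `σ_n(ℝ)`: the zero polynomial together with the polynomials of degree `n` or
`n-1` with only real, simple zeros. -/
def sigmaR (n : ℕ) (P : Polynomial ℝ) : Prop :=
  P = 0 ∨ ((P.natDegree = n ∨ P.natDegree + 1 = n) ∧
    P.roots.card = P.natDegree ∧ ∀ x ∈ P.roots, P.roots.count x = 1)

/-- `P` and `Q` have strictly interspersed zeros: `P'Q - PQ'` never vanishes. -/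
def StrictInt (P Q : Polynomial ℝ) : Prop :=
  ∀ t : ℝ, (Polynomial.derivative P * Q - P * Polynomial.derivative Q).eval t ≠ 0

end

/-- `C_k^∞(q) = ∏_{j=1}^k q^{j-1}/(1-q^j)`. -/
noncomputable def qBinomInf (q : ℝ) (k : ℕ) : ℝ :=
  ∏ j ∈ Finset.range k, q ^ j / (1 - q ^ (j + 1))

/-- `Φ(t) = ∑_{n=1}^∞ (2n⁴π²e^{9t} - 3n²πe^{5t}) e^{-n²π e^{4t}}`. -/
noncomputable def PhiRC (t : ℝ) : ℝ :=
  ∑' n : ℕ, (2 * ((n : ℝ) + 1) ^ 4 * Real.pi ^ 2 * Real.exp (9 * t)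
      - 3 * ((n : ℝ) + 1) ^ 2 * Real.pi * Real.exp (5 * t))
    * Real.exp (-((n : ℝ) + 1) ^ 2 * Real.pi * Real.exp (4 * t))

/-- `b̂_n = ∫_0^∞ t^{2n} Φ(t) dt`. -/
noncomputable def bhat (n : ℕ) : ℝ := ∫ t in Set.Ioi (0 : ℝ), t ^ (2 * n) * PhiRC t

section ZeroFree

open Topology

/-- `p` has no zeros in the open upper half-plane. -/
def NoUpperZeros (p : ℂ[X]) : Prop := ∀ w : ℂ, 0 < w.im → p.eval w ≠ 0

/-- At a point of the closed upper half-plane which is not a zero, the logarithmic derivative of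
a polynomial without zeros in the open upper half-plane has nonpositive imaginary part. -/
lemma NoUpperZeros.im_logDeriv_nonpos {p : ℂ[X]} (hp : NoUpperZeros p) {w : ℂ}
    (hw : 0 ≤ w.im) (h : p.eval w ≠ 0) : (p.derivative.eval w / p.eval w).im ≤ 0 := by
  rw [(IsAlgClosed.splits p).eval_derivative_div_eval_of_ne_zero h]
  have key : ∀ s : Multiset ℂ, (∀ x ∈ s, x.im ≤ 0) →
      ((s.map fun z ↦ 1 / (w - z)).sum).im ≤ 0 := by
    intro s
    induction s using Multiset.induction with
    | empty => simp
    | cons a s ih =>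
      intro hs
      have h1 := ih fun x hx ↦ hs x (Multiset.mem_cons_of_mem hx)
      have h2 : (1 / (w - a)).im ≤ 0 := by
        rw [one_div, Complex.inv_im]
        have ha := hs a (Multiset.mem_cons_self a s)
        apply div_nonpos_of_nonpos_of_nonneg
        · simp only [Complex.sub_im]; linarith
        · exact Complex.normSq_nonneg _
      simp only [Multiset.map_cons, Multiset.sum_cons, Complex.add_im]
      linarith
  refine key _ fun x hx ↦ ?_
  by_contra hcon
  exact hp x (not_le.mp hcon) (Polynomial.isRoot_of_mem_roots hx)

lemma eval_add_mul_derivative_ne_zero {p : ℂ[X]} (hp : NoUpperZeros p) {α : ℝ} (hα : 0 ≤ α)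
    {z : ℂ} (hz : 0 < z.im) {w : ℂ} (hw : 0 ≤ w.im) (h : p.eval w ≠ 0) :
    (p + C (α * z) * derivative p).eval w ≠ 0 := by
  intro h0
  have h1 := hp.im_logDeriv_nonpos hw h
  set L := p.derivative.eval w / p.eval w with hL
  have hz0 : z ≠ 0 := by rintro rfl; simp at hz
  have h2 : 1 + α * z * L = 0 := by
    rw [hL]; field_simp
    simpa using h0
  have h3 : (α : ℂ) * L = -z⁻¹ := by
    field_simp; linear_combination h2
  have h4 : ((α : ℂ) * L).im = α * L.im := by simp
  have h5 : 0 < (-z⁻¹).im := by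
    rw [Complex.neg_im, Complex.inv_im, neg_div, neg_neg]
    exact div_pos hz (Complex.normSq_pos.mpr hz0)
  rw [← h3, h4] at h5
  nlinarith

lemma NoUpperZeros.add_mul_derivative {p : ℂ[X]} (hp : NoUpperZeros p) {α : ℝ} (hα : 0 ≤ α)
    {z : ℂ} (hz : 0 < z.im) : NoUpperZeros (p + C (α * z) * derivative p) :=
  fun w hw ↦ eval_add_mul_derivative_ne_zero hp hα hz hw.le (hp w hw)

lemma NoUpperZeros.derivative {p : ℂ[X]} (hp : NoUpperZeros p) (h : derivative p ≠ 0) :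
    NoUpperZeros (derivative p) := by
  intro w hw h0
  have hdeg : 0 < p.degree := by
    by_contra hc
    rw [Polynomial.eq_C_of_degree_le_zero (not_lt.mp hc)] at h
    simp at h
  have hmem : w ∈ (Polynomial.derivative p).rootSet ℂ := by
    rw [mem_rootSet]; exact ⟨h, by simpa using h0⟩
  have hsub : (convexHull ℝ) (p.rootSet ℂ) ⊆ {z : ℂ | z.im ≤ 0} := by
    apply convexHull_min
    · intro x hx
      by_contra hcon
      simp only [Set.mem_ofPred_eq, not_le] at hcon
      exact hp x hcon (by simpa using (mem_rootSet.mp hx).2)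
    · exact convex_halfSpace_im_le 0
  have := hsub (rootSet_derivative_subset_convexHull_rootSet hdeg hmem)
  simp only [Set.mem_ofPred_eq] at this
  linarith

lemma NoUpperZeros.iterate_derivative {p : ℂ[X]} (hp : NoUpperZeros p) (k : ℕ)
    (h : Polynomial.derivative^[k] p ≠ 0) : NoUpperZeros (Polynomial.derivative^[k] p) := by
  induction k with
  | zero => simpa using hp
  | succ k ih =>
    rw [Function.iterate_succ_apply'] at h ⊢
    exact (ih fun h0 ↦ h (by rw [h0, derivative_zero])).derivative h

/-- The polynomial `∏ (1 + α X)` over the multiset `s`. -/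
noncomputable def linProd (s : Multiset ℝ) : ℝ[X] := (s.map fun α ↦ 1 + C α * X).prod

@[simp] lemma linProd_zero : linProd 0 = 1 := by simp [linProd]

@[simp] lemma linProd_cons (a : ℝ) (s : Multiset ℝ) :
    linProd (a ::ₘ s) = (1 + C a * X) * linProd s := by simp [linProd]

lemma linProd_eval_pos {s : Multiset ℝ} (hs : ∀ α ∈ s, 0 ≤ α) {x : ℝ} (hx : 0 ≤ x) :
    0 < (linProd s).eval x := by
  induction s using Multiset.induction with
  | empty => simp
  | cons a s ih =>
    have ha := hs a (Multiset.mem_cons_self a s)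
    have := ih fun x hx ↦ hs x (Multiset.mem_cons_of_mem hx)
    simp only [linProd_cons, eval_mul, eval_add, eval_one, eval_C, eval_X]
    positivity

lemma linProd_coeff_nonneg {s : Multiset ℝ} (hs : ∀ α ∈ s, 0 ≤ α) (k : ℕ) :
    0 ≤ (linProd s).coeff k := by
  induction s using Multiset.induction generalizing k with
  | empty => simp [coeff_one]; split_ifs <;> norm_num
  | cons a s ih =>
    have ha := hs a (Multiset.mem_cons_self a s)
    have h := ih fun x hx ↦ hs x (Multiset.mem_cons_of_mem hx)
    rw [linProd_cons, add_mul, one_mul, mul_assoc, coeff_add, coeff_C_mul]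
    cases k with
    | zero => simpa using h 0
    | succ k => rw [coeff_X_mul]; have := h k; have := h (k + 1); positivity

@[simp] lemma linProd_coeff_zero (s : Multiset ℝ) : (linProd s).coeff 0 = 1 := by
  induction s using Multiset.induction with
  | empty => simp
  | cons a s ih => simp [linProd_cons, add_mul, mul_assoc, ih]

lemma linProd_coeff_one (s : Multiset ℝ) : (linProd s).coeff 1 = s.sum := by
  induction s using Multiset.induction with
  | empty => simp [coeff_one]
  | cons a s ih => simp [linProd_cons, add_mul, mul_assoc, ih, coeff_X_mul, add_comm]

lemma aeval_linProd (s : Multiset ℝ) (z : ℂ) :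
    aeval z (linProd s) = (s.map fun α : ℝ ↦ 1 + (α : ℂ) * z).prod := by
  induction s using Multiset.induction with
  | empty => simp
  | cons a s ih => simp [linProd_cons, ih]

lemma one_add_mul_ne_zero (α : ℝ) {z : ℂ} (hz : 0 < z.im) :
    1 + (α : ℂ) * z ≠ 0 := by
  intro h
  have h1 : (1 + (α : ℂ) * z).im = 0 := by rw [h]; simp
  have h2 : α = 0 := by
    simp at h1
    rcases h1 with h1 | h1
    · exact h1
    · exact absurd h1 hz.ne'
  simp [h2] at h

lemma noUpperZeros_linProd (s : Multiset ℝ) :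
    NoUpperZeros ((linProd s).map (algebraMap ℝ ℂ)) := by
  intro w hw
  rw [eval_map_algebraMap, aeval_linProd]
  apply Multiset.prod_ne_zero
  intro h
  obtain ⟨a, -, h0⟩ := Multiset.mem_map.mp h
  exact one_add_mul_ne_zero a hw h0

/-- The Schur–Szegő type composition `∑ k! f_k h_k X^k` of two polynomials. -/
noncomputable def factComp (f h : ℝ[X]) : ℝ[X] :=
  ∑ k ∈ Finset.range (f.natDegree + 1), C ((k.factorial : ℝ) * f.coeff k * h.coeff k) * X ^ k

lemma factComp_coeff (f h : ℝ[X]) (k : ℕ) :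
    (factComp f h).coeff k = (k.factorial : ℝ) * f.coeff k * h.coeff k := by
  simp only [factComp, finsetSum_coeff, coeff_C_mul, coeff_X_pow]
  simp only [mul_ite, mul_one, mul_zero, Finset.sum_ite_eq, Finset.mem_range]
  split_ifs with hk
  · rfl
  · rw [coeff_eq_zero_of_natDegree_lt (by omega)]; simp

/-- Differentiation of complex polynomials scaled by `z`. -/
noncomputable def scaledDeriv (z : ℂ) : Module.End ℂ ℂ[X] := z • (derivative : ℂ[X] →ₗ[ℂ] ℂ[X])

lemma scaledDeriv_pow (z : ℂ) (k : ℕ) (p : ℂ[X]) :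
    (scaledDeriv z ^ k) p = C (z ^ k) * derivative^[k] p := by
  induction k with
  | zero => simp
  | succ k ih =>
    rw [pow_succ', Module.End.mul_apply, ih, Function.iterate_succ_apply']
    simp only [scaledDeriv, LinearMap.smul_apply, derivative_C_mul, smul_eq_C_mul, pow_succ,
      C_mul]
    ring

lemma eval_zero_aeval_scaledDeriv (f h : ℝ[X]) (z : ℂ) :
    (aeval (scaledDeriv z) f (h.map (algebraMap ℝ ℂ))).eval 0 = aeval z (factComp f h) := by
  rw [aeval_eq_sum_range, LinearMap.sum_apply, eval_finsetSum, factComp, map_sum]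
  refine Finset.sum_congr rfl fun k _ ↦ ?_
  rw [LinearMap.smul_apply, scaledDeriv_pow, eval_smul, eval_mul, eval_C,
    ← coeff_zero_eq_eval_zero, coeff_iterate_derivative]
  simp [Nat.descFactorial_self]
  ring

lemma aeval_scaledDeriv_linProd {s : Multiset ℝ} (hs : ∀ α ∈ s, 0 ≤ α) {z : ℂ} (hz : 0 < z.im)
    {p : ℂ[X]} (hp : NoUpperZeros p) (h0 : p.eval 0 ≠ 0) :
    NoUpperZeros (aeval (scaledDeriv z) (linProd s) p) ∧
      (aeval (scaledDeriv z) (linProd s) p).eval 0 ≠ 0 := by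
  induction s using Multiset.induction with
  | empty => simpa using ⟨hp, h0⟩
  | cons a s ih =>
    have ha := hs a (Multiset.mem_cons_self a s)
    obtain ⟨h1, h2⟩ := ih fun x hx ↦ hs x (Multiset.mem_cons_of_mem hx)
    have e : aeval (scaledDeriv z) (linProd (a ::ₘ s)) p =
        aeval (scaledDeriv z) (linProd s) p +
          C (a * z) * derivative (aeval (scaledDeriv z) (linProd s) p) := by
      rw [linProd_cons, map_mul, Module.End.mul_apply]
      simp [scaledDeriv, Algebra.smul_def, Module.algebraMap_end_apply]
      ring
    rw [e]
    exact ⟨h1.add_mul_derivative ha hz,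
      eval_add_mul_derivative_ne_zero h1 ha hz (by simp) h2⟩

/-- Schur–Szegő: composing a polynomial with nonpositive zeros and a polynomial with real zeros
does not create zeros in the upper half-plane. -/
theorem aeval_factComp_ne_zero {s : Multiset ℝ} (hs : ∀ α ∈ s, 0 ≤ α) {h : ℝ[X]}
    (hp : NoUpperZeros (h.map (algebraMap ℝ ℂ))) (h0 : h.coeff 0 ≠ 0) {z : ℂ} (hz : 0 < z.im) :
    aeval z (factComp (linProd s) h) ≠ 0 := by
  rw [← eval_zero_aeval_scaledDeriv]
  refine (aeval_scaledDeriv_linProd hs hz hp ?_).2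
  rw [← coeff_zero_eq_eval_zero, coeff_map]
  simpa using h0

/-- Newton's inequalities for polynomials with only nonpositive zeros. -/
theorem newton_inequality_linProd {s : Multiset ℝ} (hs : ∀ α ∈ s, 0 ≤ α) (k : ℕ) :
    (k.factorial * (linProd s).coeff k) * ((k + 2).factorial * (linProd s).coeff (k + 2)) ≤
      ((k + 1).factorial * (linProd s).coeff (k + 1)) ^ 2 := by
  set γ : ℕ → ℝ := fun k ↦ k.factorial * (linProd s).coeff k with hγ
  change γ k * γ (k + 2) ≤ γ (k + 1) ^ 2
  have hγ0 : ∀ k, 0 ≤ γ k := fun k ↦ mul_nonneg (by positivity) (linProd_coeff_nonneg hs k)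
  by_contra hcon
  push Not at hcon
  have hk : γ k ≠ 0 := by intro h; rw [h] at hcon; nlinarith [sq_nonneg (γ (k + 1))]
  have hk2 : γ (k + 2) ≠ 0 := by intro h; rw [h] at hcon; nlinarith [sq_nonneg (γ (k + 1))]
  have hk2' : 0 < γ (k + 2) := lt_of_le_of_ne (hγ0 _) hk2.symm
  set P := (linProd s).map (algebraMap ℝ ℂ) with hP
  have hev : ∀ j, (derivative^[j] P).eval 0 = (γ j : ℂ) := by
    intro j
    rw [← coeff_zero_eq_eval_zero, coeff_iterate_derivative, hP, coeff_map]
    simp [hγ, Nat.descFactorial_self]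
  have hne : (derivative^[k] P).eval 0 ≠ 0 := by rw [hev]; exact_mod_cast hk
  have hU : NoUpperZeros (derivative^[k] P) :=
    (noUpperZeros_linProd s).iterate_derivative k fun h ↦ hne (by rw [h]; simp)
  set D := γ k * γ (k + 2) - γ (k + 1) ^ 2 with hD
  have hDpos : 0 < D := by linarith
  set z : ℂ := ((-γ (k + 1) / γ (k + 2) : ℝ) : ℂ) + ((√D / γ (k + 2) : ℝ) : ℂ) * Complex.I with hz
  have hzim : 0 < z.im := by
    have : z.im = √D / γ (k + 2) := by
      rw [hz, Complex.add_im, Complex.ofReal_im, Complex.im_ofReal_mul, Complex.I_im]; ring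
    rw [this]; exact div_pos (Real.sqrt_pos.mpr hDpos) hk2'
  have h1 := hU.add_mul_derivative zero_le_one hzim
  have h2 := eval_add_mul_derivative_ne_zero hU zero_le_one hzim (w := 0) (by simp) hne
  have h3 := eval_add_mul_derivative_ne_zero h1 zero_le_one hzim (w := 0) (by simp) h2
  apply h3
  have e1 : derivative (derivative^[k] P) = derivative^[k + 1] P :=
    (Function.iterate_succ_apply' _ _ _).symm
  have e2 : derivative (derivative^[k + 1] P) = derivative^[k + 2] P :=
    (Function.iterate_succ_apply' _ _ _).symm
  simp only [derivative_add, derivative_C_mul, e1, e2, eval_add, eval_mul, eval_C, hev,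
    Complex.ofReal_one, one_mul]
  have hsq : ((√D : ℝ) : ℂ) ^ 2 = γ k * γ (k + 2) - γ (k + 1) ^ 2 := by
    rw [← Complex.ofReal_pow, Real.sq_sqrt hDpos.le, hD]; push_cast; ring
  have hne2 : (γ (k + 2) : ℂ) ≠ 0 := by exact_mod_cast hk2
  have hz' : z * γ (k + 2) = -γ (k + 1) + √D * Complex.I := by
    rw [hz]; push_cast; field_simp
  have hfin : (γ (k + 2) : ℂ) * (γ k + z * γ (k + 1) + z * (γ (k + 1) + z * γ (k + 2))) = 0 := by
    have : (γ (k + 2) : ℂ) * (γ k + z * γ (k + 1) + z * (γ (k + 1) + z * γ (k + 2))) =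
      γ (k + 2) * γ k + 2 * γ (k + 1) * (z * γ (k + 2)) + (z * γ (k + 2)) ^ 2 := by ring
    rw [this, hz']
    linear_combination (Complex.I ^ 2) * hsq + (γ k * γ (k + 2) - γ (k + 1) ^ 2) * Complex.I_sq
  exact (mul_eq_zero.mp hfin).resolve_left hne2

end ZeroFree

section Separation

open Topology

/-- A real polynomial all of whose zeros are negative is a product of factors `1 + β X`. -/
lemma exists_eq_linProd (n : ℕ) : ∀ g : ℝ[X], g.natDegree = n → g.coeff 0 = 1 →
    (∀ z : ℂ, 0 < z.im → aeval z g ≠ 0) → (∀ x : ℝ, 0 ≤ x → g.eval x ≠ 0) →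
    ∃ t : Multiset ℝ, (∀ β ∈ t, 0 < β) ∧ g = linProd t := by
  induction n with
  | zero =>
    intro g hg h0 _ _
    refine ⟨0, by simp, ?_⟩
    rw [Polynomial.eq_C_of_natDegree_eq_zero hg, h0]; simp
  | succ n ih =>
    intro g hg h0 hU hR
    have hdeg : 0 < (g.map (algebraMap ℝ ℂ)).degree := by
      rw [degree_map, ← natDegree_pos_iff_degree_pos]; omega
    obtain ⟨z, hz⟩ := Complex.exists_root hdeg
    have hz' : aeval z g = 0 := by rwa [IsRoot.def, eval_map_algebraMap] at hz
    have hconj : aeval (starRingEnd ℂ z) g = 0 := by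
      rw [Polynomial.aeval_conj, hz', map_zero]
    have him : z.im = 0 := by
      rcases lt_trichotomy z.im 0 with h | h | h
      · exact absurd hconj (hU _ (by simpa using h))
      · exact h
      · exact absurd hz' (hU _ h)
    obtain ⟨x, rfl⟩ : ∃ x : ℝ, z = x := ⟨z.re, by apply Complex.ext <;> simp [him]⟩
    have hx : g.eval x = 0 := by
      have : aeval (x : ℂ) g = ((g.eval x : ℝ) : ℂ) := by
        simpa using Polynomial.aeval_algebraMap_apply ℂ x g
      rw [this] at hz'; exact_mod_cast hz'
    have hxneg : x < 0 := by
      by_contra h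
      exact hR x (not_lt.mp h) hx
    obtain ⟨r, hr⟩ := dvd_iff_isRoot.mpr hx
    have hfac : g = (1 + C (-x⁻¹) * X) * (C (-x) * r) := by
      rw [hr]
      have : (1 + C (-x⁻¹) * X) * C (-x) = X - C x := by
        rw [add_mul, one_mul, mul_right_comm, ← C_mul]
        have hx' : x ≠ 0 := hxneg.ne
        have : -x⁻¹ * -x = 1 := by field_simp
        rw [this, C_1, one_mul, C_neg]; ring
      rw [← mul_assoc, this]
    have hr0 : r ≠ 0 := by rintro rfl; simp at hr; simp [hr] at h0
    have hdeg' : (C (-x) * r).natDegree = n := by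
      rw [natDegree_C_mul (by linarith)]
      have : g.natDegree = 1 + r.natDegree := by
        rw [hr, natDegree_mul (X_sub_C_ne_zero x) hr0, natDegree_X_sub_C]
      omega
    obtain ⟨t, ht, hgt⟩ := ih (C (-x) * r) hdeg' (by
        rw [hfac, mul_coeff_zero] at h0
        simpa using h0) (by
        intro z hz h
        refine hU z hz ?_
        rw [hfac, map_mul, h, mul_zero]) (by
        intro y hy h
        refine hR y hy ?_
        rw [hfac, eval_mul, h, mul_zero])
    refine ⟨(-x⁻¹) ::ₘ t, ?_, by rw [linProd_cons, ← hgt, ← hfac]⟩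
    intro β hβ
    rcases Multiset.mem_cons.mp hβ with rfl | h
    · rw [neg_pos]; exact inv_lt_zero.mpr hxneg
    · exact ht β h

/-- The sum of the arguments of the factors `1 + β z`. -/
noncomputable def argSum (t : Multiset ℝ) (z : ℂ) : ℝ :=
  (t.map fun β : ℝ ↦ (1 + (β : ℂ) * z).arg).sum

lemma aeval_linProd_eq_norm_mul_exp (t : Multiset ℝ) (z : ℂ) :
    aeval z (linProd t) = ‖aeval z (linProd t)‖ * Complex.exp (argSum t z * Complex.I) := by
  induction t using Multiset.induction with
  | empty => simp [argSum]
  | cons a t ih =>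
    have e : argSum (a ::ₘ t) z = (1 + (a : ℂ) * z).arg + argSum t z := by simp [argSum]
    have e2 : aeval z (linProd (a ::ₘ t)) = (1 + (a : ℂ) * z) * aeval z (linProd t) := by
      simp [linProd_cons]
    rw [e, e2, norm_mul]
    conv_lhs => rw [ih, ← Complex.norm_mul_exp_arg_mul_I (1 + (a : ℂ) * z)]
    push_cast
    rw [add_mul, Complex.exp_add]
    ring

lemma arg_one_add_sub_arg {w : ℂ} (hw : 0 < w.im) {q : ℝ} (hq0 : 0 < q) (hq1 : q < 1) :
    0 < (1 + w).arg - (1 + q * w).arg ∧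
    (((1 + w) * starRingEnd ℂ (1 + q * w)).re < 0 →
      Real.pi / 2 < (1 + w).arg - (1 + q * w).arg) := by
  set u := 1 + w with hu
  set v := 1 + (q : ℂ) * w with hv
  have hui : 0 < u.im := by simpa [hu] using hw
  have hvi : 0 < v.im := by simpa [hv] using mul_pos hq0 hw
  have hu0 : u ≠ 0 := by rintro h; simp [h] at hui
  have hv0 : v ≠ 0 := by rintro h; simp [h] at hvi
  have hprod : u * starRingEnd ℂ v =
      ((‖u‖ * ‖v‖ : ℝ) : ℂ) * Complex.exp ((u.arg - v.arg : ℝ) * Complex.I) := by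
    conv_lhs => rw [← Complex.norm_mul_exp_arg_mul_I u, ← Complex.norm_mul_exp_arg_mul_I v]
    rw [map_mul, Complex.conj_ofReal, ← Complex.exp_conj, map_mul, Complex.conj_I,
      Complex.conj_ofReal]
    have : Complex.exp ((u.arg - v.arg : ℝ) * Complex.I) =
        Complex.exp (u.arg * Complex.I) * Complex.exp (v.arg * -Complex.I) := by
      rw [← Complex.exp_add]; congr 1; push_cast; ring
    rw [this]; push_cast; ring
  have hpos : 0 < ‖u‖ * ‖v‖ := mul_pos (norm_pos_iff.mpr hu0) (norm_pos_iff.mpr hv0)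
  have him : (u * starRingEnd ℂ v).im = ‖u‖ * ‖v‖ * Real.sin (u.arg - v.arg) := by
    rw [hprod, Complex.im_ofReal_mul, Complex.exp_ofReal_mul_I_im]
  have hre : (u * starRingEnd ℂ v).re = ‖u‖ * ‖v‖ * Real.cos (u.arg - v.arg) := by
    rw [hprod, Complex.re_ofReal_mul, Complex.exp_ofReal_mul_I_re]
  have him' : 0 < (u * starRingEnd ℂ v).im := by
    have : (u * starRingEnd ℂ v).im = (1 - q) * w.im := by simp [hu, hv]; ring
    rw [this]; exact mul_pos (by linarith) hw
  have hsin : 0 < Real.sin (u.arg - v.arg) := by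
    rw [him] at him'; exact (mul_pos_iff_of_pos_left hpos).mp him'
  have hb1 := Complex.arg_le_pi u
  have hb2 : 0 ≤ v.arg := Complex.arg_nonneg_iff.mpr hvi.le
  have hb3 := Complex.arg_le_pi v
  have hb4 : 0 ≤ u.arg := Complex.arg_nonneg_iff.mpr hui.le
  have hd : 0 < u.arg - v.arg := by
    by_contra h
    exact absurd (Real.sin_nonpos_of_nonpos_of_neg_pi_le (not_lt.mp h) (by linarith))
      (not_le.mpr hsin)
  refine ⟨hd, fun h ↦ ?_⟩
  by_contra hcon
  rw [hre] at h
  have := Real.cos_nonneg_of_neg_pi_div_two_le_of_le (x := u.arg - v.arg)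
    (by linarith [Real.pi_pos]) (not_lt.mp hcon)
  nlinarith

lemma one_add_mul_mem_slitPlane {β : ℝ} (hβ : 0 ≤ β) {z : ℂ} (hz : z ∈ Complex.slitPlane) :
    1 + (β : ℂ) * z ∈ Complex.slitPlane := by
  rcases hβ.eq_or_lt with rfl | hβ
  · simp
  rw [Complex.mem_slitPlane_iff] at hz ⊢
  rcases hz with h | h
  · left; simp; positivity
  · right; simp [hβ.ne', h]

lemma continuousOn_argSum {t : Multiset ℝ} (ht : ∀ β ∈ t, 0 < β) :
    ContinuousOn (argSum t) Complex.slitPlane := by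
  induction t using Multiset.induction with
  | empty =>
    have : argSum 0 = fun _ ↦ 0 := by ext; simp [argSum]
    rw [this]; exact continuousOn_const
  | cons a t ih =>
    have e : argSum (a ::ₘ t) = fun z ↦ (1 + (a : ℂ) * z).arg + argSum t z := by
      ext z; simp [argSum]
    rw [e]
    refine ContinuousOn.add ?_ (ih fun x hx ↦ ht x (Multiset.mem_cons_of_mem hx))
    intro z hz
    have h := Complex.continuousAt_arg
      (one_add_mul_mem_slitPlane (ht a (Multiset.mem_cons_self a t)).le hz)
    have h2 : ContinuousAt (fun z : ℂ ↦ 1 + (a : ℂ) * z) z := by fun_prop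
    exact (ContinuousAt.comp (f := fun z : ℂ ↦ 1 + (a : ℂ) * z) h h2).continuousWithinAt

lemma argSum_sub_nonneg {t : Multiset ℝ} (ht : ∀ β ∈ t, 0 < β) {q : ℝ} (hq0 : 0 < q)
    (hq1 : q < 1) {z : ℂ} (hz : 0 < z.im) : 0 ≤ argSum t z - argSum t (q * z) := by
  induction t using Multiset.induction with
  | empty => simp [argSum]
  | cons a t ih =>
    have ha := ht a (Multiset.mem_cons_self a t)
    have h1 := ih fun x hx ↦ ht x (Multiset.mem_cons_of_mem hx)
    have h2 := (arg_one_add_sub_arg (w := a * z) (by simpa using mul_pos ha hz) hq0 hq1).1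
    rw [mul_left_comm] at h2
    simp only [argSum, Multiset.map_cons, Multiset.sum_cons] at h1 ⊢
    linarith

/-- If no nonnegative combination of `g(z)` and `g(qz)` has zeros in the upper half-plane,
then the zeros of `g` are logarithmically `q`-separated. -/
theorem le_mul_of_combination_ne_zero {t : Multiset ℝ} (ht : ∀ β ∈ t, 0 < β) {q : ℝ}
    (hq0 : 0 < q) (hq1 : q < 1)
    (H : ∀ c : ℝ, 0 ≤ c → ∀ z : ℂ, 0 < z.im →
      aeval z (linProd t) + c * aeval (q * z) (linProd t) ≠ 0)
    {a b : ℝ} {t' : Multiset ℝ} (hab : t = a ::ₘ b ::ₘ t') (hba : b ≤ a) : b ≤ q * a := by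
  by_contra hcon
  push Not at hcon
  have ha : 0 < a := ht a (by simp [hab])
  have hb : 0 < b := ht b (by simp [hab])
  obtain ⟨x, hx1, hx2⟩ : ∃ x, 1 / b < x ∧ x < 1 / (q * a) :=
    exists_between (one_div_lt_one_div_of_lt (by positivity) hcon)
  have hx0 : 0 < x := lt_trans (by positivity) hx1
  have hbx : 1 < b * x := by rw [div_lt_iff₀ hb] at hx1; linarith
  have hax : 1 < a * x := hbx.trans_le (by gcongr)
  have hqa : q * a * x < 1 := by
    rw [lt_div_iff₀ (by positivity)] at hx2; linarith
  have hqb : q * b * x < 1 := lt_of_le_of_lt (by gcongr) hqa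
  set ζ : ℝ → ℂ := fun θ ↦ x * Complex.exp (θ * Complex.I) with hζ
  have hζc : Continuous ζ := by fun_prop
  have hζim : ∀ θ, (ζ θ).im = x * Real.sin θ := fun θ ↦ by
    simp only [hζ]; rw [Complex.im_ofReal_mul, Complex.exp_ofReal_mul_I_im]
  have hζre : ∀ θ, (ζ θ).re = x * Real.cos θ := fun θ ↦ by
    simp only [hζ]; rw [Complex.re_ofReal_mul, Complex.exp_ofReal_mul_I_re]
  have hπ : ζ Real.pi = -x := by simp [hζ, Complex.exp_pi_mul_I]
  have hnear : ∀ c : ℝ, 1 < c * x → q * c * x < 1 → ∀ᶠ θ in 𝓝 Real.pi,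
      ((1 + c * ζ θ) * starRingEnd ℂ (1 + q * (c * ζ θ))).re < 0 := by
    intro c hc1 hc2
    have hcont : Continuous fun θ ↦ ((1 + c * ζ θ) * starRingEnd ℂ (1 + q * (c * ζ θ))).re := by
      fun_prop
    refine hcont.continuousAt.eventually_lt continuousAt_const ?_
    rw [hπ]
    have : ((1 + (c : ℂ) * -x) * starRingEnd ℂ (1 + q * (c * -x))).re =
        (1 - c * x) * (1 - q * c * x) := by simp; ring
    rw [this]
    exact mul_neg_of_neg_of_pos (by linarith) (by linarith)
  have hev := ((hnear a hax hqa).and (hnear b hbx hqb)).filter_mono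
    (nhdsWithin_le_nhds (s := Set.Iio Real.pi))
  obtain ⟨θ₁, ⟨h1, h2⟩, hθ0, hθπ⟩ :=
    (hev.and (Ioo_mem_nhdsLT (Real.pi_pos))).exists
  have him1 : 0 < (ζ θ₁).im := by
    rw [hζim]; exact mul_pos hx0 (Real.sin_pos_of_pos_of_lt_pi hθ0 hθπ)
  set F : ℝ → ℝ := fun θ ↦ argSum t (ζ θ) - argSum t (q * ζ θ) with hF
  have hF1 : Real.pi < F θ₁ := by
    have e1 := (arg_one_add_sub_arg (w := a * ζ θ₁) (by simpa using mul_pos ha him1) hq0 hq1).2 h1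
    have e2 := (arg_one_add_sub_arg (w := b * ζ θ₁) (by simpa using mul_pos hb him1) hq0 hq1).2 h2
    have e3 := argSum_sub_nonneg (t := t') (fun β hβ ↦ ht β (by simp [hab, hβ])) hq0 hq1 him1
    rw [mul_left_comm (q : ℂ)] at e1 e2
    simp only [hF, hab, argSum, Multiset.map_cons, Multiset.sum_cons] at e3 ⊢
    linarith
  have hF0 : F 0 = 0 := by
    have hz : ∀ y : ℝ, 0 ≤ y → argSum t y = 0 := by
      intro y hy
      refine Multiset.sum_eq_zero fun u hu ↦ ?_
      obtain ⟨β, hβ, rfl⟩ := Multiset.mem_map.mp hu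
      have : 1 + (β : ℂ) * y = ((1 + β * y : ℝ) : ℂ) := by push_cast; ring
      rw [this]
      exact Complex.arg_ofReal_of_nonneg (by have := ht β hβ; positivity)
    have e0 : ζ 0 = (x : ℂ) := by simp [hζ]
    have e1 := hz x hx0.le
    have e2 := hz (q * x) (by positivity)
    push_cast at e2
    simp only [hF, e0, e1, e2, sub_self]
  have hslit : ∀ θ ∈ Set.Icc 0 θ₁, ζ θ ∈ Complex.slitPlane := by
    intro θ hθ
    rw [Complex.mem_slitPlane_iff, hζre, hζim]
    rcases hθ.1.eq_or_lt with rfl | h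
    · left; simpa using hx0
    · right
      exact (mul_pos hx0 (Real.sin_pos_of_pos_of_lt_pi h (hθ.2.trans_lt hθπ))).ne'
  have hFc : ContinuousOn F (Set.Icc 0 θ₁) := by
    refine ContinuousOn.sub ((continuousOn_argSum ht).comp hζc.continuousOn hslit)
      ((continuousOn_argSum ht).comp (f := fun θ ↦ (q : ℂ) * ζ θ)
        (by fun_prop) fun θ hθ ↦ ?_)
    have := hslit θ hθ
    rw [Complex.mem_slitPlane_iff] at this ⊢
    simpa [hq0, hq0.ne'] using this
  obtain ⟨θ, hθ, hθF⟩ := intermediate_value_Icc hθ0.le hFc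
    (show Real.pi ∈ Set.Icc (F 0) (F θ₁) from ⟨by rw [hF0]; exact Real.pi_pos.le, hF1.le⟩)
  have hθ0' : 0 < θ := by
    rcases hθ.1.eq_or_lt with h | h
    · rw [← h, hF0] at hθF; exact absurd hθF.symm Real.pi_pos.ne'
    · exact h
  have him : 0 < (ζ θ).im := by
    rw [hζim]; exact mul_pos hx0 (Real.sin_pos_of_pos_of_lt_pi hθ0' (hθ.2.trans_lt hθπ))
  have him' : 0 < ((q : ℂ) * ζ θ).im := by simpa using mul_pos hq0 him
  have hne : aeval ((q : ℂ) * ζ θ) (linProd t) ≠ 0 := by simpa using H 0 le_rfl _ him'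
  refine H (‖aeval (ζ θ) (linProd t)‖ / ‖aeval ((q : ℂ) * ζ θ) (linProd t)‖) (by positivity)
    (ζ θ) him ?_
  have hexp : Complex.exp (argSum t (ζ θ) * Complex.I) =
      -Complex.exp (argSum t (q * ζ θ) * Complex.I) := by
    have : argSum t (ζ θ) = Real.pi + argSum t (q * ζ θ) := by
      simp only [hF] at hθF; linarith
    rw [this]; push_cast
    rw [add_mul, Complex.exp_add, Complex.exp_pi_mul_I]; ring
  have hn : (‖aeval ((q : ℂ) * ζ θ) (linProd t)‖ : ℂ) ≠ 0 := by
    exact_mod_cast norm_ne_zero_iff.mpr hne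
  have e1 := aeval_linProd_eq_norm_mul_exp t (ζ θ)
  have e2 := aeval_linProd_eq_norm_mul_exp t (q * ζ θ)
  generalize aeval (ζ θ) (linProd t) = A at *
  generalize aeval ((q : ℂ) * ζ θ) (linProd t) = B at *
  rw [hexp] at e1
  push_cast
  field_simp
  rw [show A * (‖B‖ : ℂ) = ‖A‖ * -Complex.exp (argSum t (q * ζ θ) * Complex.I) * ‖B‖ by rw [← e1]]
  linear_combination (‖A‖ : ℂ) * e2

end Separation

section QBinomial

open Topology

lemma Rpoly_eq_linProd (n : ℕ) (q : ℝ) :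
    Rpoly n q = linProd ((Multiset.range n).map fun j ↦ q ^ j) := by
  rw [Rpoly, linProd, Multiset.map_map]; rfl

lemma Rpoly_comp (n : ℕ) (q : ℝ) : (Rpoly n q).comp (C q * X) =
    ∏ j ∈ Finset.range n, (1 + C (q ^ (j + 1)) * X) := by
  rw [Rpoly, prod_comp]
  refine Finset.prod_congr rfl fun j _ ↦ ?_
  simp only [add_comp, one_comp, mul_comp, C_comp, X_comp, pow_succ, C_mul]
  ring

lemma Rpoly_succ (n : ℕ) (q : ℝ) :
    Rpoly (n + 1) q = (1 + X) * ∏ j ∈ Finset.range n, (1 + C (q ^ (j + 1)) * X) := by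
  rw [Rpoly, Finset.prod_range_succ', mul_comm]; simp

lemma Rpoly_succ_comp (n : ℕ) (q : ℝ) : (Rpoly (n + 1) q).comp (C q * X) =
    (1 + C (q ^ (n + 1)) * X) * ∏ j ∈ Finset.range n, (1 + C (q ^ (j + 1)) * X) := by
  rw [Rpoly_comp, Finset.prod_range_succ, mul_comm]

lemma Rpoly_coeff_succ (n k : ℕ) (q : ℝ) : (Rpoly n q).coeff (k + 1) * (1 - q ^ (k + 1)) =
    (Rpoly n q).coeff k * (q ^ k - q ^ n) := by
  have h : (1 + C (q ^ n) * X) * Rpoly n q = (1 + X) * (Rpoly n q).comp (C q * X) := by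
    rw [Rpoly_comp, ← Rpoly_succ, Rpoly, Rpoly, Finset.prod_range_succ, mul_comm]
  have h2 := congrArg (fun p ↦ p.coeff (k + 1)) h
  simp only [add_mul, one_mul, coeff_add, mul_assoc, coeff_C_mul, coeff_X_mul,
    comp_C_mul_X_coeff] at h2
  linear_combination h2

lemma Rpoly_coeff_zero (n : ℕ) (q : ℝ) : (Rpoly n q).coeff 0 = 1 := by
  rw [Rpoly_eq_linProd, linProd_coeff_zero]

lemma Rpoly_coeff_nonneg (n k : ℕ) {q : ℝ} (hq0 : 0 < q) : 0 ≤ (Rpoly n q).coeff k := by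
  rw [Rpoly_eq_linProd]
  refine linProd_coeff_nonneg (fun α hα ↦ ?_) k
  obtain ⟨j, -, rfl⟩ := Multiset.mem_map.mp hα
  positivity

lemma qBinomInf_succ (q : ℝ) (k : ℕ) :
    qBinomInf q (k + 1) = qBinomInf q k * (q ^ k / (1 - q ^ (k + 1))) := by
  rw [qBinomInf, Finset.prod_range_succ]; rfl

lemma one_sub_pow_succ_pos {q : ℝ} (hq0 : 0 < q) (hq1 : q < 1) (k : ℕ) : 0 < 1 - q ^ (k + 1) :=
  sub_pos.mpr (pow_lt_one₀ hq0.le hq1 k.succ_ne_zero)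

lemma qBinomInf_pos {q : ℝ} (hq0 : 0 < q) (hq1 : q < 1) (k : ℕ) : 0 < qBinomInf q k :=
  Finset.prod_pos fun j _ ↦ div_pos (pow_pos hq0 j) (one_sub_pow_succ_pos hq0 hq1 j)

lemma Rpoly_coeff_succ_eq {q : ℝ} (hq0 : 0 < q) (hq1 : q < 1) (n k : ℕ) :
    (Rpoly n q).coeff (k + 1) = (Rpoly n q).coeff k * ((q ^ k - q ^ n) / (1 - q ^ (k + 1))) := by
  have := one_sub_pow_succ_pos hq0 hq1 k
  rw [← mul_div_assoc, eq_div_iff this.ne', Rpoly_coeff_succ]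

lemma Rpoly_coeff_le {q : ℝ} (hq0 : 0 < q) (hq1 : q < 1) (n k : ℕ) :
    (Rpoly n q).coeff k ≤ qBinomInf q k := by
  induction k with
  | zero => simp [Rpoly_coeff_zero, qBinomInf]
  | succ k ih =>
    have := one_sub_pow_succ_pos hq0 hq1 k
    have h0 := Rpoly_coeff_nonneg n k hq0
    rw [Rpoly_coeff_succ_eq hq0 hq1, qBinomInf_succ]
    calc _ ≤ (Rpoly n q).coeff k * (q ^ k / (1 - q ^ (k + 1))) := by
          gcongr; linarith [pow_pos hq0 n]
      _ ≤ _ := by gcongr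

lemma tendsto_Rpoly_coeff {q : ℝ} (hq0 : 0 < q) (hq1 : q < 1) (k : ℕ) :
    Tendsto (fun n ↦ (Rpoly n q).coeff k) atTop (𝓝 (qBinomInf q k)) := by
  induction k with
  | zero => simp [Rpoly_coeff_zero, qBinomInf]
  | succ k ih =>
    simp only [Rpoly_coeff_succ_eq hq0 hq1, qBinomInf_succ]
    refine ih.mul (Tendsto.div_const ?_ _)
    simpa using tendsto_const_nhds.sub (tendsto_pow_atTop_nhds_zero_of_lt_one hq0.le hq1)

lemma noUpperZeros_Rpoly_combination (n : ℕ) (q : ℝ) {c : ℝ} (hc : 0 ≤ c) :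
    NoUpperZeros ((Rpoly (n + 1) q + C c * (Rpoly (n + 1) q).comp (C q * X)).map
      (algebraMap ℝ ℂ)) := by
  intro w hw
  have e : Rpoly (n + 1) q + C c * (Rpoly (n + 1) q).comp (C q * X) =
      C (1 + c) * linProd ((1 + c * q ^ (n + 1)) / (1 + c) ::ₘ
        (Multiset.range n).map fun j ↦ q ^ (j + 1)) := by
    have h1 : ∏ j ∈ Finset.range n, (1 + C (q ^ (j + 1)) * X) =
        linProd ((Multiset.range n).map fun j ↦ q ^ (j + 1)) := by
      rw [linProd, Multiset.map_map]; rfl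
    have h2 : C (1 + c) * (C ((1 + c * q ^ (n + 1)) / (1 + c)) * X) =
        (1 + C c * C (q ^ (n + 1))) * X := by
      rw [← mul_assoc, ← C_mul, mul_div_cancel₀ _ (by positivity), C_add, C_mul, C_1]
    rw [Rpoly_succ_comp, Rpoly_succ, linProd_cons, ← h1]
    linear_combination (exp := 1) (-∏ j ∈ Finset.range n, (1 + C (q ^ (j + 1)) * X)) * h2 +
      (-∏ j ∈ Finset.range n, (1 + C (q ^ (j + 1)) * X)) * (C_add (a := (1:ℝ)) (b := c)) +
      (-∏ j ∈ Finset.range n, (1 + C (q ^ (j + 1)) * X)) * (C_1 (R := ℝ))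
  rw [e, Polynomial.map_mul, eval_mul, map_C, eval_C]
  refine mul_ne_zero ?_ (noUpperZeros_linProd _ w hw)
  have : (1 + c : ℝ) ≠ 0 := by positivity
  simpa using (by exact_mod_cast this : ((1 + c : ℝ) : ℂ) ≠ 0)

lemma linProd_coeff_le_eval_one {s : Multiset ℝ} (hs : ∀ α ∈ s, 0 ≤ α) (k : ℕ) :
    (linProd s).coeff k ≤ (linProd s).eval 1 := by
  rw [eval_eq_sum_range]
  simp only [one_pow, mul_one]
  by_cases hk : k ∈ Finset.range ((linProd s).natDegree + 1)
  · exact Finset.single_le_sum (f := fun i ↦ (linProd s).coeff i)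
      (fun i _ ↦ linProd_coeff_nonneg hs i) hk
  · rw [coeff_eq_zero_of_natDegree_lt (by simp at hk; omega)]
    exact Finset.sum_nonneg fun i _ ↦ linProd_coeff_nonneg hs i

/-- The finite version of the separation theorem. -/
theorem exists_separated_factComp {s : Multiset ℝ} (hs : ∀ α ∈ s, 0 ≤ α) {q : ℝ}
    (hq0 : 0 < q) (hq1 : q < 1) (n : ℕ) :
    ∃ (β : ℕ → ℝ) (m : ℕ), (∀ j, 0 ≤ β j) ∧ (∀ j, β (j + 1) ≤ q * β j) ∧ (∀ j, m ≤ j → β j = 0) ∧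
      factComp (linProd s) (Rpoly (n + 1) q) = linProd ((Multiset.range m).map β) := by
  set g := factComp (linProd s) (Rpoly (n + 1) q) with hg
  have hcomb : ∀ c : ℝ, 0 ≤ c → ∀ z : ℂ, 0 < z.im → aeval z g + c * aeval (q * z) g ≠ 0 := by
    intro c hc z hz
    have h0 : (Rpoly (n + 1) q + C c * (Rpoly (n + 1) q).comp (C q * X)).coeff 0 ≠ 0 := by
      have : (1 + c : ℝ) ≠ 0 := by positivity
      rw [coeff_add, coeff_C_mul, comp_C_mul_X_coeff, Rpoly_coeff_zero]
      simpa using this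
    have h := aeval_factComp_ne_zero hs (noUpperZeros_Rpoly_combination n q hc) h0 hz
    have e : factComp (linProd s) (Rpoly (n + 1) q + C c * (Rpoly (n + 1) q).comp (C q * X)) =
        g + C c * g.comp (C q * X) := by
      ext k
      simp only [hg, coeff_add, coeff_C_mul, comp_C_mul_X_coeff, factComp_coeff]
      ring
    rw [e] at h
    simpa [aeval_comp] using h
  have hU : ∀ z : ℂ, 0 < z.im → aeval z g ≠ 0 := fun z hz ↦ by simpa using hcomb 0 le_rfl z hz
  have hg0 : g.coeff 0 = 1 := by simp [hg, factComp_coeff, Rpoly_coeff_zero]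
  have hgc : ∀ k, 0 ≤ g.coeff k := fun k ↦ by
    rw [hg, factComp_coeff]
    exact mul_nonneg (mul_nonneg (by positivity) (linProd_coeff_nonneg hs k))
      (Rpoly_coeff_nonneg _ k hq0)
  obtain ⟨t, ht, hgt⟩ := exists_eq_linProd g.natDegree g rfl hg0 hU (by
    intro x hx h
    rw [eval_eq_sum_range, Finset.sum_range_succ'] at h
    have : 0 ≤ ∑ k ∈ Finset.range g.natDegree, g.coeff (k + 1) * x ^ (k + 1) :=
      Finset.sum_nonneg fun k _ ↦ mul_nonneg (hgc _) (by positivity)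
    rw [hg0] at h
    simp at h
    linarith)
  set l := t.sort (· ≥ ·) with hl
  have hpw : l.Pairwise (· ≥ ·) := Multiset.pairwise_sort t _
  have hlt : (l : Multiset ℝ) = t := Multiset.sort_eq t _
  have hlpos : ∀ x ∈ l, 0 < x := fun x hx ↦ ht x (by rw [← hlt]; exact hx)
  have hget : ∀ (i : ℕ) (h : i < l.length), l.getD i 0 = l[i] := fun i h ↦ by
    simp [List.getD_eq_getElem?_getD, h]
  have hnon : ∀ j, 0 ≤ l.getD j 0 := fun j ↦ by
    by_cases h : j < l.length
    · rw [hget j h]; exact (hlpos _ (List.getElem_mem h)).le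
    · rw [List.getD_eq_default _ _ (not_lt.mp h)]
  refine ⟨fun j ↦ l.getD j 0, l.length, hnon, fun j ↦ ?_, fun j hj ↦ List.getD_eq_default _ _ hj, ?_⟩
  · change l.getD (j + 1) 0 ≤ q * l.getD j 0
    by_cases h : j + 1 < l.length
    · have hp := List.pairwise_iff_getElem.mp hpw j (j + 1) (by omega) h (Nat.lt_succ_self j)
      have hsplit : l = l.take j ++ l[j] :: l[j + 1] :: l.drop (j + 2) := by
        conv_lhs => rw [← List.take_append_drop j l, List.drop_eq_getElem_cons (by omega),
          List.drop_eq_getElem_cons h]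
      have ht2 : t = l[j] ::ₘ l[j + 1] ::ₘ ((l.take j : Multiset ℝ) + (l.drop (j + 2) : Multiset ℝ)) := by
        conv_lhs => rw [← hlt, hsplit]
        rw [← Multiset.coe_add, ← Multiset.cons_coe, ← Multiset.cons_coe, Multiset.add_cons,
          Multiset.add_cons]
      rw [hget _ h, hget j (by omega)]
      exact le_mul_of_combination_ne_zero ht hq0 hq1 (by rw [← hgt]; exact hcomb) ht2 hp
    · rw [List.getD_eq_default _ _ (not_lt.mp h)]
      exact mul_nonneg hq0.le (hnon j)
  · rw [hgt, ← hlt]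
    congr 1
    have : l = (List.range l.length).map fun j ↦ l.getD j 0 := by
      refine List.ext_getElem (by simp) fun i h1 h2 ↦ ?_
      simp [h1]
    conv_lhs => rw [this]
    rw [← Multiset.map_coe]
    rfl

end QBinomial

section Limit

open Topology

lemma summable_factorial_mul_qBinomInf {q : ℝ} (hq0 : 0 < q) (hq1 : q < 1) {r : ℝ} (hr : 0 < r) :
    Summable fun k : ℕ ↦ (k.factorial : ℝ) * qBinomInf q k * r ^ k := by
  have hpos : ∀ k : ℕ, 0 < (k.factorial : ℝ) * qBinomInf q k * r ^ k := fun k ↦ by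
    have := qBinomInf_pos hq0 hq1 k
    positivity
  refine summable_of_ratio_test_tendsto_lt_one (l := 0) one_pos
    (Eventually.of_forall fun k ↦ (hpos k).ne') ?_
  have e : ∀ k : ℕ, ‖((k + 1).factorial : ℝ) * qBinomInf q (k + 1) * r ^ (k + 1)‖ /
      ‖(k.factorial : ℝ) * qBinomInf q k * r ^ k‖ =
      (k * q ^ k + q ^ k) * r / (1 - q ^ (k + 1)) := by
    intro k
    have h1 := qBinomInf_pos hq0 hq1 k
    have h2 := one_sub_pow_succ_pos hq0 hq1 k
    have h3 : (0 : ℝ) < k.factorial := by positivity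
    rw [Real.norm_of_nonneg (hpos _).le, Real.norm_of_nonneg (hpos _).le, qBinomInf_succ,
      Nat.factorial_succ]
    push_cast
    field_simp
    ring
  simp only [e]
  have h1 := tendsto_self_mul_const_pow_of_lt_one hq0.le hq1
  have h2 := tendsto_pow_atTop_nhds_zero_of_lt_one hq0.le hq1
  have h3 : Tendsto (fun k : ℕ ↦ 1 - q ^ (k + 1)) atTop (𝓝 (1 - 0)) :=
    tendsto_const_nhds.sub ((tendsto_add_atTop_iff_nat 1).mpr h2)
  have h4 := ((h1.add h2).mul_const r).div h3 (by norm_num)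
  rw [add_zero, zero_mul, zero_div] at h4
  exact h4

lemma geometric_bound {β : ℕ → ℝ} {q K : ℝ} (hq0 : 0 ≤ q) (h0 : β 0 ≤ K)
    (h : ∀ j, β (j + 1) ≤ q * β j) (j : ℕ) : β j ≤ K * q ^ j := by
  induction j with
  | zero => simpa using h0
  | succ j ih =>
    calc β (j + 1) ≤ q * β j := h j
      _ ≤ q * (K * q ^ j) := by gcongr
      _ = K * q ^ (j + 1) := by ring

/-- If a coefficient sequence is a limit of coefficient sequences of polynomials with negative
zeros, then weighting with `C_k^∞(q) k!` produces an entire function with logarithmically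
`q`-separated zeros. -/
theorem exists_separated_limit {a : ℕ → ℝ} {s : ℕ → Multiset ℝ} (hs : ∀ N, ∀ α ∈ s N, 0 ≤ α)
    (hlim : ∀ k, Tendsto (fun N ↦ (linProd (s N)).coeff k) atTop (𝓝 (a k))) {B : ℝ}
    (hB : ∀ N, (linProd (s N)).eval 1 ≤ B) {q : ℝ} (hq0 : 0 < q) (hq1 : q < 1) :
    ∃ β : ℕ → ℝ, (∀ j, 0 ≤ β j) ∧ (∀ j, β (j + 1) ≤ q * β j) ∧
      ∀ z : ℂ, Multipliable (fun j ↦ 1 + (β j : ℂ) * z) ∧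
        HasSum (fun k ↦ ((qBinomInf q k * (k.factorial * a k) : ℝ) : ℂ) * z ^ k)
          (∏' j, (1 + (β j : ℂ) * z)) := by
  choose b m hb0 hbq hbm hb using fun N ↦ exists_separated_factComp (hs N) hq0 hq1 N
  have hB0 : 0 ≤ B := (linProd_eval_pos (hs 0) zero_le_one).le.trans (hB 0)
  have hcB : ∀ N k, (linProd (s N)).coeff k ≤ B := fun N k ↦
    (linProd_coeff_le_eval_one (hs N) k).trans (hB N)
  set K : ℝ := B * qBinomInf q 1 with hK
  have hK0 : 0 ≤ K := mul_nonneg hB0 (qBinomInf_pos hq0 hq1 1).le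
  have hbK : ∀ N, b N 0 ≤ K := by
    intro N
    by_cases hm : m N = 0
    · rw [hbm N 0 hm.le]; exact hK0
    have h1 : b N 0 ≤ ((Multiset.range (m N)).map (b N)).sum := by
      refine Multiset.single_le_sum (fun x hx ↦ ?_) _ ?_
      · obtain ⟨j, -, rfl⟩ := Multiset.mem_map.mp hx
        exact hb0 N j
      · exact Multiset.mem_map_of_mem _ (Multiset.mem_range.mpr (Nat.pos_of_ne_zero hm))
    rw [← linProd_coeff_one, ← hb, factComp_coeff] at h1
    refine h1.trans ?_
    rw [Nat.factorial_one, Nat.cast_one, one_mul]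
    exact mul_le_mul (hcB N 1) (Rpoly_coeff_le hq0 hq1 _ _) (Rpoly_coeff_nonneg _ _ hq0) hB0
  have hgeo : ∀ N j, b N j ≤ K * q ^ j := fun N ↦ geometric_bound hq0.le (hbK N) (hbq N)
  set 𝒰 : Ultrafilter ℕ := hyperfilter ℕ with h𝒰
  have hle : (𝒰 : Filter ℕ) ≤ atTop := Nat.hyperfilter_le_atTop
  have hex : ∀ j, ∃ x, Tendsto (fun N ↦ b N j) 𝒰 (𝓝 x) := by
    intro j
    obtain ⟨x, -, hx⟩ := (isCompact_Icc (a := (0 : ℝ)) (b := K * q ^ j)).ultrafilter_le_nhds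
      (𝒰.map fun N ↦ b N j) (by
        rw [le_principal_iff]
        exact Filter.mem_map.mpr (Eventually.of_forall fun N ↦ ⟨hb0 N j, hgeo N j⟩))
    exact ⟨x, hx⟩
  choose β hβ using hex
  have hβ0 : ∀ j, 0 ≤ β j := fun j ↦ ge_of_tendsto' (hβ j) fun N ↦ hb0 N j
  have hβq : ∀ j, β (j + 1) ≤ q * β j := fun j ↦
    le_of_tendsto_of_tendsto' (hβ (j + 1)) ((hβ j).const_mul q) fun N ↦ hbq N j
  have hβK : ∀ j, β j ≤ K * q ^ j := fun j ↦ le_of_tendsto' (hβ j) fun N ↦ hgeo N j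
  refine ⟨β, hβ0, hβq, fun z ↦ ?_⟩
  have hsumK : Summable fun j : ℕ ↦ K * q ^ j * ‖z‖ :=
    ((summable_geometric_of_lt_one hq0.le hq1).mul_left K).mul_right _
  have hnb : ∀ {x : ℝ} {j : ℕ}, 0 ≤ x → x ≤ K * q ^ j → ‖(x : ℂ) * z‖ ≤ K * q ^ j * ‖z‖ := by
    intro x j h0 h1
    rw [norm_mul, Complex.norm_real, Real.norm_of_nonneg h0]
    gcongr
  refine ⟨multipliable_one_add_of_summable
    (hsumK.of_nonneg_of_le (fun _ ↦ norm_nonneg _) fun j ↦ hnb (hβ0 j) (hβK j)), ?_⟩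
  have hprod : Tendsto (fun N ↦ ∏' j, (1 + (b N j : ℂ) * z)) 𝒰 (𝓝 (∏' j, (1 + (β j : ℂ) * z))) :=
    tendsto_tprod_one_add_of_dominated_convergence hsumK
      (fun j ↦ ((Complex.continuous_ofReal.tendsto _).comp (hβ j)).mul_const z)
      (Eventually.of_forall fun N j ↦ hnb (hb0 N j) (hgeo N j))
  have hr : 0 < ‖z‖ + 1 := by positivity
  have hsumC := (summable_factorial_mul_qBinomInf hq0 hq1 hr).mul_left B
  have hcoef : ∀ N k, 0 ≤ (factComp (linProd (s N)) (Rpoly (N + 1) q)).coeff k ∧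
      (factComp (linProd (s N)) (Rpoly (N + 1) q)).coeff k ≤
        B * (k.factorial * qBinomInf q k) := by
    intro N k
    have h1 := linProd_coeff_nonneg (hs N) k
    have h2 := Rpoly_coeff_nonneg (N + 1) k hq0
    have h3 := hcB N k
    have h4 := Rpoly_coeff_le hq0 hq1 (N + 1) k
    rw [factComp_coeff]
    refine ⟨by positivity, ?_⟩
    calc _ ≤ k.factorial * B * qBinomInf q k := by gcongr
      _ = _ := by ring
  have hclim : ∀ k, Tendsto (fun N ↦ (factComp (linProd (s N)) (Rpoly (N + 1) q)).coeff k) 𝒰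
      (𝓝 (qBinomInf q k * (k.factorial * a k))) := by
    intro k
    simp only [factComp_coeff]
    rw [mul_comm]
    exact (((hlim k).const_mul _).mono_left hle).mul
      (((tendsto_add_atTop_iff_nat 1).mpr (tendsto_Rpoly_coeff hq0 hq1 k)).mono_left hle)
  have hcoefz : ∀ {x : ℝ} {k : ℕ}, 0 ≤ x → x ≤ B * (k.factorial * qBinomInf q k) →
      ‖(x : ℂ) * z ^ k‖ ≤ B * (k.factorial * qBinomInf q k * (‖z‖ + 1) ^ k) := by
    intro x k h0 h1
    rw [norm_mul, Complex.norm_real, Real.norm_of_nonneg h0, norm_pow, ← mul_assoc]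
    refine mul_le_mul h1 ?_ (by positivity) (h0.trans h1)
    gcongr
    linarith
  have hsum : Tendsto (fun N ↦ ∑' k,
        (((factComp (linProd (s N)) (Rpoly (N + 1) q)).coeff k : ℝ) : ℂ) * z ^ k) 𝒰
      (𝓝 (∑' k, ((qBinomInf q k * (k.factorial * a k) : ℝ) : ℂ) * z ^ k)) :=
    tendsto_tsum_of_dominated_convergence hsumC
      (fun k ↦ ((Complex.continuous_ofReal.tendsto _).comp (hclim k)).mul_const _)
      (Eventually.of_forall fun N k ↦ hcoefz (hcoef N k).1 (hcoef N k).2)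
  have heq : ∀ N, ∑' k, (((factComp (linProd (s N)) (Rpoly (N + 1) q)).coeff k : ℝ) : ℂ) * z ^ k =
      ∏' j, (1 + (b N j : ℂ) * z) := by
    intro N
    have h1 : ∏' j, (1 + (b N j : ℂ) * z) = ∏ j ∈ Finset.range (m N), (1 + (b N j : ℂ) * z) :=
      tprod_eq_prod fun j hj ↦ by rw [hbm N j (by simpa using hj)]; simp
    have h2 : aeval z (linProd ((Multiset.range (m N)).map (b N))) =
        ∏ j ∈ Finset.range (m N), (1 + (b N j : ℂ) * z) := by
      rw [aeval_linProd, Multiset.map_map]; rfl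
    rw [h1, ← h2, hb, aeval_eq_sum_range, tsum_eq_sum]
    · refine Finset.sum_congr rfl fun k _ ↦ ?_
      rw [Algebra.smul_def]; rfl
    · intro k hk
      rw [coeff_eq_zero_of_natDegree_lt (by simp at hk; omega)]; simp
  have hfin := tendsto_nhds_unique (hsum.congr heq) hprod
  rw [← hfin]
  refine Summable.hasSum (Summable.of_norm_bounded hsumC fun k ↦ ?_)
  exact hcoefz (ge_of_tendsto' (hclim k) fun N ↦ (hcoef N k).1)
    (le_of_tendsto' (hclim k) fun N ↦ (hcoef N k).2)

end Limit

section Assembly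

open Topology

lemma antitone_decay {β : ℕ → ℝ} {q : ℝ} (hq1 : q < 1) (h0 : ∀ j, 0 ≤ β j)
    (h : ∀ j, β (j + 1) ≤ q * β j) {j l : ℕ} (hjl : j < l) : β l ≤ q * β j := by
  have hanti : Antitone β := antitone_nat_of_succ_le fun j ↦
    (h j).trans (mul_le_of_le_one_left (h0 j) hq1.le)
  exact (hanti hjl).trans (h j)

/-- A product of factors `1 + β_j z` with `q`-decaying `β` is of the form required by the class
`𝓝̄_∞(q)`. -/
theorem exists_zeros_of_decay {β : ℕ → ℝ} {q : ℝ} (hq0 : 0 < q) (hq1 : q < 1) (h0 : ∀ j, 0 ≤ β j)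
    (h : ∀ j, β (j + 1) ≤ q * β j) (hm : ∀ z : ℂ, Multipliable fun j ↦ 1 + (β j : ℂ) * z) :
    ∃ (N : WithTop ℕ) (x : ℕ → ℝ),
      (∀ z : ℂ, Multipliable
        (fun j : {j : ℕ // (j : WithTop ℕ) < N} => 1 - z / ((x j : ℝ) : ℂ))) ∧
      (∀ z : ℂ, ∏' j, (1 + (β j : ℂ) * z) =
        ∏' j : {j : ℕ // (j : WithTop ℕ) < N}, (1 - z / ((x j : ℝ) : ℂ))) ∧
      (∀ j : ℕ, (j : WithTop ℕ) < N → x j ≤ 0) ∧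
      (∀ j l : ℕ, (j : WithTop ℕ) < N → (l : WithTop ℕ) < N → j ≠ l →
        ((x l ≤ x j ∧ x j < 0) ∨ (0 < x j ∧ x j ≤ x l)) → x j / x l ≤ q) ∧
      (∃ ε : ℝ, 0 < ε ∧ ∀ j : ℕ, (j : WithTop ℕ) < N → ε ≤ |x j|) := by
  have hdec := fun {j l} ↦ antitone_decay (j := j) (l := l) hq1 h0 h
  obtain ⟨N, hN⟩ : ∃ N : WithTop ℕ, ∀ j : ℕ, (j : WithTop ℕ) < N ↔ 0 < β j := by
    by_cases hz : ∃ j, β j = 0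
    · refine ⟨(Nat.find hz : ℕ), fun j ↦ ?_⟩
      rw [Nat.cast_lt]
      constructor
      · intro hj
        exact lt_of_le_of_ne (h0 j) (Ne.symm (Nat.find_min hz hj))
      · intro hj
        by_contra hcon
        rcases (not_lt.mp hcon).eq_or_lt with he | hlt
        · rw [← he, Nat.find_spec hz] at hj; exact lt_irrefl _ hj
        · have := hdec hlt
          rw [Nat.find_spec hz] at this
          linarith
    · push Not at hz
      exact ⟨⊤, fun j ↦ ⟨fun _ ↦ lt_of_le_of_ne (h0 j) (hz j).symm, fun _ ↦ WithTop.coe_lt_top j⟩⟩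
  have hsupp : ∀ z : ℂ, Function.mulSupport (fun j ↦ 1 + (β j : ℂ) * z) ⊆
      {j : ℕ | (j : WithTop ℕ) < N} := by
    intro z j hj
    rw [Set.mem_ofPred_eq, hN]
    refine lt_of_le_of_ne (h0 j) fun he ↦ hj ?_
    simp [← he]
  have hfac : ∀ z : ℂ, (fun j : {j : ℕ // (j : WithTop ℕ) < N} ↦
      1 - z / (((fun j ↦ -(β j)⁻¹) (j : ℕ) : ℝ) : ℂ)) =
      (fun j ↦ 1 + (β j : ℂ) * z) ∘ (Subtype.val : {j : ℕ | (j : WithTop ℕ) < N} → ℕ) := by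
    intro z
    ext j
    simp only [Function.comp_apply]
    push_cast
    rw [div_neg, div_inv_eq_mul]; ring
  have hneg : ∀ {j : ℕ}, (j : WithTop ℕ) < N → -(β j)⁻¹ < 0 := fun {j} hj ↦ by
    rw [neg_lt_zero]; exact inv_pos.mpr ((hN j).mp hj)
  refine ⟨N, fun j ↦ -(β j)⁻¹, fun z ↦ ?_, fun z ↦ ?_, fun j hj ↦ (hneg hj).le, ?_, ?_⟩
  · rw [hfac]
    exact ((hasProd_subtype_iff_of_mulSupport_subset (hsupp z)).mpr (hm z).hasProd).multipliable
  · rw [hfac]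
    exact (tprod_subtype_eq_of_mulSupport_subset (hsupp z)).symm
  · intro j l hj hl hjl hcase
    have hj' := (hN j).mp hj
    have hl' := (hN l).mp hl
    rcases hcase with ⟨h1, -⟩ | ⟨h1, -⟩
    · have h2 : β l ≤ β j := by
        have : (β j)⁻¹ ≤ (β l)⁻¹ := by simpa using h1
        exact (inv_le_inv₀ hj' hl').mp this
      have h3 : β l ≤ q * β j := by
        rcases lt_or_gt_of_ne hjl with hlt | hgt
        · exact hdec hlt
        · have := hdec hgt
          nlinarith
      have : -(β j)⁻¹ / -(β l)⁻¹ = β l / β j := by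
        rw [neg_div_neg_eq, inv_div_inv]
      simp only [this]
      rw [div_le_iff₀ hj']
      exact h3
    · exact absurd h1 (not_lt.mpr (hneg hj).le)
  · rcases (h0 0).eq_or_lt with he | hpos
    · refine ⟨1, one_pos, fun j hj ↦ ?_⟩
      have hj' := (hN j).mp hj
      rcases Nat.eq_zero_or_pos j with rfl | hj0
      · exact absurd he hj'.ne
      · have := hdec hj0
        rw [← he, mul_zero] at this
        linarith
    · refine ⟨(β 0)⁻¹, inv_pos.mpr hpos, fun j hj ↦ ?_⟩
      have hj' := (hN j).mp hj
      rw [abs_neg, abs_of_pos (inv_pos.mpr hj')]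
      refine inv_anti₀ hj' ?_
      rcases Nat.eq_zero_or_pos j with rfl | hj0
      · exact le_rfl
      · exact (hdec hj0).trans (mul_le_of_le_one_left hpos.le hq1.le)

/-- The conclusion of the main theorem, for any sequence `b` for which `b k / (2k)!` is up to a
positive factor a limit of coefficient sequences of polynomials with negative zeros. -/
theorem separated_and_logConcave_of_approx {b : ℕ → ℝ} (hb : 0 < b 0) {s : ℕ → Multiset ℝ}
    (hs : ∀ N, ∀ α ∈ s N, 0 ≤ α)
    (hlim : ∀ k, Tendsto (fun N ↦ (linProd (s N)).coeff k) atTop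
      (𝓝 (b k / ((2 * k).factorial * b 0)))) {B : ℝ} (hB : ∀ N, (linProd (s N)).eval 1 ≤ B) :
    (∀ q : ℝ, 0 < q → q < 1 →
      ∃ (f : ℂ → ℂ) (c : ℝ) (m : ℕ) (N : WithTop ℕ) (x : ℕ → ℝ),
        (∀ z : ℂ, HasSum (fun k : ℕ =>
          ((qBinomInf q k * ((Nat.factorial k : ℝ) * b k /
            (Nat.factorial (2 * k) : ℝ)) : ℝ) : ℂ) * z ^ k) (f z)) ∧
        (∀ z : ℂ, Multipliable
          (fun j : {j : ℕ // (j : WithTop ℕ) < N} => 1 - z / ((x j : ℝ) : ℂ))) ∧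
        (∀ z : ℂ, f z = ((c : ℝ) : ℂ) * z ^ m *
          ∏' j : {j : ℕ // (j : WithTop ℕ) < N}, (1 - z / ((x j : ℝ) : ℂ))) ∧
        (∀ j : ℕ, (j : WithTop ℕ) < N → x j ≤ 0) ∧
        (∀ j l : ℕ, (j : WithTop ℕ) < N → (l : WithTop ℕ) < N → j ≠ l →
          ((x l ≤ x j ∧ x j < 0) ∨ (0 < x j ∧ x j ≤ x l)) → x j / x l ≤ q) ∧
        (∃ ε : ℝ, 0 < ε ∧ ∀ j : ℕ, (j : WithTop ℕ) < N → ε ≤ |x j|)) ∧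
    (∀ n : ℕ, 1 ≤ n →
      ((Nat.factorial (n - 1) : ℝ) * b (n - 1) / (Nat.factorial (2 * n - 2) : ℝ)) *
        ((Nat.factorial (n + 1) : ℝ) * b (n + 1) / (Nat.factorial (2 * n + 2) : ℝ)) ≤
      ((Nat.factorial n : ℝ) * b n / (Nat.factorial (2 * n) : ℝ)) ^ 2) := by
  refine ⟨fun q hq0 hq1 ↦ ?_, fun n hn ↦ ?_⟩
  · obtain ⟨β, h0, h, hβ⟩ := exists_separated_limit hs hlim hB hq0 hq1
    obtain ⟨N, x, h1, h2, h3, h4, h5⟩ := exists_zeros_of_decay hq0 hq1 h0 h fun z ↦ (hβ z).1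
    refine ⟨fun z ↦ (b 0 : ℂ) * ∏' j, (1 + (β j : ℂ) * z), b 0, 0, N, x, fun z ↦ ?_, h1,
      fun z ↦ ?_, h3, h4, h5⟩
    · have e : ∀ k : ℕ, ((qBinomInf q k * ((k.factorial : ℝ) * b k /
          ((2 * k).factorial : ℝ)) : ℝ) : ℂ) * z ^ k = (b 0 : ℂ) *
          (((qBinomInf q k * (k.factorial * (b k / ((2 * k).factorial * b 0))) : ℝ) : ℂ) * z ^ k) := by
        intro k
        rw [← mul_assoc, ← Complex.ofReal_mul]
        congr 2
        have : ((2 * k).factorial : ℝ) ≠ 0 := by positivity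
        field_simp
      simp only [e]
      exact (hβ z).2.mul_left (b 0 : ℂ)
    · simp only [pow_zero, mul_one, h2]
  · obtain ⟨k, rfl⟩ : ∃ k, n = k + 1 := ⟨n - 1, by omega⟩
    have hl := fun k ↦ (hlim k).const_mul (k.factorial : ℝ)
    have := le_of_tendsto_of_tendsto' ((hl k).mul (hl (k + 2))) ((hl (k + 1)).pow 2)
      fun N ↦ newton_inequality_linProd (hs N) k
    have e1 : k + 1 - 1 = k := by omega
    have e2 : 2 * (k + 1) - 2 = 2 * k := by omega
    have e3 : 2 * (k + 1) + 2 = 2 * (k + 2) := by omega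
    rw [e1, e2, e3]
    have e : ∀ j, (j.factorial : ℝ) * b j / ((2 * j).factorial : ℝ) =
        b 0 * (j.factorial * (b j / ((2 * j).factorial * b 0))) := by
      intro j
      have : ((2 * j).factorial : ℝ) ≠ 0 := by positivity
      field_simp
    rw [e, e, e]
    have h2 := mul_le_mul_of_nonneg_left this (sq_nonneg (b 0))
    linarith

end Assembly

section Factorization

open Topology Metric

lemma hasFPowerSeriesOnBall_of_hasSum {a : ℕ → ℂ} {h : ℂ → ℂ}
    (H : ∀ z, HasSum (fun k ↦ a k * z ^ k) (h z)) :
    HasFPowerSeriesOnBall h (FormalMultilinearSeries.ofScalars ℂ a) 0 ⊤ where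
  r_le := by
    refine (FormalMultilinearSeries.radius_eq_top_of_summable_norm _ fun r ↦ ?_).ge
    have := (H r).summable.norm
    simpa [FormalMultilinearSeries.ofScalars_norm] using this
  r_pos := by simp
  hasSum := by
    intro y _
    simpa [FormalMultilinearSeries.ofScalars_apply_eq, smul_eq_mul, mul_comm] using H y

lemma differentiable_of_hasSum {a : ℕ → ℂ} {h : ℂ → ℂ}
    (H : ∀ z, HasSum (fun k ↦ a k * z ^ k) (h z)) : Differentiable ℂ h := by
  have := (hasFPowerSeriesOnBall_of_hasSum H).differentiableOn
  rw [← differentiableOn_univ]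
  simpa using this

lemma norm_coeff_le_of_hasSum {a : ℕ → ℂ} {h : ℂ → ℂ}
    (H : ∀ z, HasSum (fun k ↦ a k * z ^ k) (h z)) {ε : ℝ} (hε : ∀ z, ‖z‖ = 1 → ‖h z‖ ≤ ε) (k : ℕ) :
    ‖a k‖ ≤ ε := by
  have hp := hasFPowerSeriesOnBall_of_hasSum H
  have h1 := hp.hasFPowerSeriesAt.eq_formalMultilinearSeries
    hp.hasFPowerSeriesAt.analyticAt.hasFPowerSeriesAt
  have h2 : a k = iteratedDeriv k h 0 / k.factorial := by
    have := congrArg (fun p ↦ p.coeff k) h1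
    simpa [FormalMultilinearSeries.coeff_ofScalars] using this
  have h3 := Complex.norm_iteratedDeriv_le_of_forall_mem_sphere_norm_le k one_pos
    (differentiable_of_hasSum H).diffContOnCl (c := 0) (C := ε) (by simpa using hε)
  have hk : (0 : ℝ) < k.factorial := by positivity
  rw [h2, norm_div, Complex.norm_natCast, div_le_iff₀ hk]
  simpa [mul_comm] using h3

/-- Dividing out finitely many zeros so that no zeros remain in a disc. -/
lemma exists_factorization_disc {F : ℂ → ℂ} (hF : Differentiable ℂ F) (h0 : F 0 = 1)
    (hzero : ∀ z, F z = 0 → ∃ x : ℝ, x < 0 ∧ z = x) {R : ℝ} (hR : 0 < R) :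
    ∃ (s : Multiset ℝ) (G : ℂ → ℂ), (∀ α ∈ s, 1 / R ≤ α) ∧ Differentiable ℂ G ∧
      (∀ z, F z = aeval z (linProd s) * G z) ∧ ∀ z, ‖z‖ ≤ R → G z ≠ 0 := by
  set P : ℕ → Prop := fun n ↦ ∃ (s : Multiset ℝ) (G : ℂ → ℂ), s.card = n ∧ (∀ α ∈ s, 1 / R ≤ α) ∧
    Differentiable ℂ G ∧ ∀ z, F z = aeval z (linProd s) * G z with hP
  obtain ⟨M, hM⟩ := (isCompact_sphere (0 : ℂ) (3 * R)).exists_bound_of_continuousOn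
    hF.continuous.continuousOn
  have hbound : ∀ n, P n → (2 : ℝ) ^ n ≤ M := by
    rintro n ⟨s, G, rfl, hs, hG, hFG⟩
    have hG0 : G 0 = 1 := by
      have := hFG 0
      rw [h0, aeval_linProd] at this
      simpa using this.symm
    have hlow : ∀ z : ℂ, ‖z‖ = 3 * R → (2 : ℝ) ^ s.card ≤ ‖aeval z (linProd s)‖ := by
      intro z hz
      clear hFG
      induction s using Multiset.induction with
      | empty => simp
      | cons a s ih =>
        have h1 := ih fun α hα ↦ hs α (Multiset.mem_cons_of_mem hα)
        have ha := hs a (Multiset.mem_cons_self a s)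
        have ha0 : 0 < a := lt_of_lt_of_le (by positivity) ha
        have h2 : 2 ≤ ‖1 + (a : ℂ) * z‖ := by
          have h3 := norm_sub_norm_le ((a : ℂ) * z) (-1)
          rw [norm_mul, Complex.norm_real, Real.norm_of_nonneg ha0.le, hz, norm_neg, norm_one,
            sub_neg_eq_add, add_comm (_ * z)] at h3
          rw [div_le_iff₀ hR] at ha
          linarith
        rw [linProd_cons, map_mul, norm_mul, Multiset.card_cons, pow_succ']
        refine mul_le_mul ?_ h1 (by positivity) (norm_nonneg _)
        simpa using h2
    have hmax := Complex.norm_le_of_forall_mem_frontier_norm_le (U := ball (0 : ℂ) (3 * R))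
      isBounded_ball hG.diffContOnCl (C := M / 2 ^ s.card) (fun z hz ↦ by
        rw [frontier_ball _ (by positivity)] at hz
        have h1 := hM z hz
        have h2 := hlow z (by simpa using hz)
        rw [hFG, norm_mul] at h1
        rw [le_div_iff₀ (by positivity)]
        calc _ ≤ ‖G z‖ * ‖aeval z (linProd s)‖ := by gcongr
          _ ≤ M := by rw [mul_comm]; exact h1) (z := 0)
        (subset_closure (mem_ball_self (by positivity)))
    rw [hG0, norm_one, le_div_iff₀ (by positivity), one_mul] at hmax
    exact hmax
  obtain ⟨b, hb⟩ := pow_unbounded_of_one_lt M (one_lt_two (α := ℝ))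
  have hPb : ∀ n, P n → n ≤ b := by
    intro n hn
    by_contra hcon
    have := hbound n hn
    have h2 : (2 : ℝ) ^ b ≤ 2 ^ n := pow_le_pow_right₀ one_le_two (not_le.mp hcon).le
    linarith
  have hP0 : P 0 := ⟨0, F, by simp, by simp, hF, by simp⟩
  have hPmax : P (Nat.findGreatest P b) := Nat.findGreatest_spec (Nat.zero_le b) hP0
  obtain ⟨s, G, hcard, hs, hG, hFG⟩ := hPmax
  refine ⟨s, G, hs, hG, hFG, fun z hz hGz ↦ ?_⟩
  have hFz : F z = 0 := by rw [hFG, hGz, mul_zero]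
  obtain ⟨x, hx, rfl⟩ := hzero z hFz
  have hxR : -x ≤ R := by
    rw [Complex.norm_real, Real.norm_eq_abs, abs_of_neg hx] at hz; exact hz
  have hPs : P (s.card + 1) := by
    refine ⟨(-x⁻¹) ::ₘ s, fun w ↦ -x * dslope G x w, by simp, ?_, ?_, fun w ↦ ?_⟩
    · intro α hα
      rcases Multiset.mem_cons.mp hα with rfl | hα
      · rw [← inv_neg, one_div]
        exact inv_anti₀ (by linarith) hxR
      · exact hs α hα
    · refine Differentiable.const_mul ?_ _
      rw [← differentiableOn_univ]
      exact (Complex.differentiableOn_dslope univ_mem).mpr hG.differentiableOn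
    · have h1 := sub_smul_dslope G x w
      rw [hGz, sub_zero, smul_eq_mul] at h1
      rw [hFG, ← h1, linProd_cons, map_mul]
      have hx0 : (x : ℂ) ≠ 0 := by exact_mod_cast hx.ne
      simp
      field_simp
      ring
  have := Nat.le_findGreatest (P := P) (hPb _ hPs) hPs
  omega

/-- A nonvanishing function on a disc which grows slowly is close to a constant near the centre. -/
lemma norm_sub_one_le_of_nonvanishing {G : ℂ → ℂ} (hG : Differentiable ℂ G) (h0 : G 0 = 1)
    {R M : ℝ} (hR : 2 ≤ R) (hM : 0 < M) (hne : ∀ z, ‖z‖ ≤ R → G z ≠ 0)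
    (hbd : ∀ z, ‖z‖ ≤ R → ‖G z‖ ≤ Real.exp M) (hMR : 4 * M / R ≤ 1) {z : ℂ} (hz : ‖z‖ ≤ 1) :
    ‖G z - 1‖ ≤ 8 * M / R := by
  have hR0 : 0 < R := by linarith
  have hne' : ∀ z ∈ ball (0 : ℂ) R, G z ≠ 0 := fun z hz ↦ hne z (mem_ball_zero_iff.mp hz).le
  have hlog : DifferentiableOn ℂ (fun z ↦ deriv G z / G z) (ball 0 R) :=
    (hG.deriv.differentiableOn).div hG.differentiableOn hne'
  obtain ⟨g, hg0, hg⟩ := hlog.isExactOn_ball.with_val_at 0 0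
  have hgd : DifferentiableOn ℂ g (ball 0 R) := fun z hz ↦
    (hg z hz).differentiableAt.differentiableWithinAt
  have hexp : ∀ z ∈ ball (0 : ℂ) R, G z = Complex.exp (g z) := by
    have hderiv : ∀ z ∈ ball (0 : ℂ) R,
        HasDerivAt (fun z ↦ G z * Complex.exp (-g z)) 0 z := by
      intro z hz
      have h1 := (hG z).hasDerivAt.mul ((hg z hz).neg.cexp)
      refine h1.congr_deriv ?_
      have := hne' z hz
      rw [Pi.neg_apply]
      field_simp
      ring
    intro z hz
    have hc := (convex_ball (0 : ℂ) R).is_const_of_fderivWithin_eq_zero (𝕜 := ℂ)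
      (f := fun z ↦ G z * Complex.exp (-g z))
      (fun z hz ↦ (hderiv z hz).differentiableAt.differentiableWithinAt) (fun z hz ↦ by
        rw [fderivWithin_of_isOpen isOpen_ball hz]
        ext
        simp [(hderiv z hz).deriv]) (mem_ball_self hR0) hz
    simp only [h0, hg0, neg_zero, Complex.exp_zero, mul_one] at hc
    rw [Complex.exp_neg] at hc
    have := Complex.exp_ne_zero (g z)
    field_simp at hc
    exact hc.symm
  have hz1 : z ∈ ball (0 : ℂ) R := mem_ball_zero_iff.mpr (by linarith)
  have hgz := Complex.borelCaratheodory_zero hM hgd (fun z hz ↦ by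
    have h1 := hbd z (mem_ball_zero_iff.mp hz).le
    rw [hexp z hz, Complex.norm_exp] at h1
    exact Real.exp_le_exp.mp h1) hR0 hz1 hg0
  have hgz2 : ‖g z‖ ≤ 4 * M / R := by
    refine hgz.trans ?_
    rw [div_le_div_iff₀ (by linarith) hR0]
    have hn := norm_nonneg z
    nlinarith [mul_nonneg hM.le (by nlinarith : 0 ≤ 2 * (R - ‖z‖) - ‖z‖ * R)]
  rw [hexp z hz1]
  have := Complex.norm_exp_sub_one_le (hgz2.trans hMR)
  calc _ ≤ 2 * ‖g z‖ := this
    _ ≤ 2 * (4 * M / R) := by gcongr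
    _ = 8 * M / R := by ring

/-- An entire function with negative zeros and at most minimal exponential type is locally
uniformly approximated by polynomials with negative zeros. -/
theorem exists_linProd_approx {F : ℂ → ℂ} (hF : Differentiable ℂ F) (h0 : F 0 = 1)
    (hzero : ∀ z, F z = 0 → ∃ x : ℝ, x < 0 ∧ z = x)
    (hgrowth : ∀ δ : ℝ, 0 < δ → ∃ K : ℝ, ∀ z, ‖F z‖ ≤ K * Real.exp (δ * ‖z‖))
    {ε : ℝ} (hε : 0 < ε) :
    ∃ s : Multiset ℝ, (∀ α ∈ s, 0 ≤ α) ∧ ∀ z, ‖z‖ ≤ 1 → ‖aeval z (linProd s) - F z‖ ≤ ε := by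
  obtain ⟨B, hB⟩ := (isCompact_closedBall (0 : ℂ) 1).exists_bound_of_continuousOn
    hF.continuous.continuousOn
  have hB1 : 1 ≤ B := by simpa [h0] using hB 0 (by simp)
  set η : ℝ := min (1 / 2) (ε / (2 * B)) with hη
  have hη0 : 0 < η := by positivity
  obtain ⟨K, hK⟩ := hgrowth (η / 32) (by positivity)
  obtain ⟨K', hK'1, hK'⟩ : ∃ K' : ℝ, 1 < K' ∧ K ≤ K' := ⟨max 2 K, by simp, le_max_right _ _⟩
  set R : ℝ := max 2 (16 * Real.log K' / η) with hRdef
  have hR2 : 2 ≤ R := le_max_left _ _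
  have hR0 : 0 < R := by linarith
  set M : ℝ := Real.log K' + η / 16 * R with hM
  have hlog : 0 < Real.log K' := Real.log_pos hK'1
  have hM0 : 0 < M := by positivity
  have hMR : 8 * M ≤ η * R := by
    have : 16 * Real.log K' ≤ η * R := by
      have := le_max_right 2 (16 * Real.log K' / η)
      rw [div_le_iff₀ hη0] at this
      linarith
    rw [hM]; linarith
  have hη2 : η ≤ 1 / 2 := min_le_left _ _
  obtain ⟨s, G, hs, hG, hFG, hne⟩ := exists_factorization_disc hF h0 hzero hR0
  have hs0 : ∀ α ∈ s, 0 < α := fun α hα ↦ lt_of_lt_of_le (by positivity) (hs α hα)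
  have hG0 : G 0 = 1 := by
    have := hFG 0
    rw [h0, aeval_linProd] at this
    simpa using this.symm
  have hlow : ∀ z : ℂ, ‖z‖ = 2 * R → 1 ≤ ‖aeval z (linProd s)‖ := by
    intro z hz
    clear hFG hs0
    induction s using Multiset.induction with
    | empty => simp
    | cons a s ih =>
      have h1 := ih fun α hα ↦ hs α (Multiset.mem_cons_of_mem hα)
      have ha := hs a (Multiset.mem_cons_self a s)
      have ha0 : 0 < a := lt_of_lt_of_le (by positivity) ha
      have h2 : 1 ≤ ‖1 + (a : ℂ) * z‖ := by
        have h3 := norm_sub_norm_le ((a : ℂ) * z) (-1)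
        rw [norm_mul, Complex.norm_real, Real.norm_of_nonneg ha0.le, hz, norm_neg, norm_one,
          sub_neg_eq_add, add_comm (_ * z)] at h3
        rw [div_le_iff₀ hR0] at ha
        linarith
      rw [linProd_cons, map_mul, norm_mul]
      refine one_le_mul_of_one_le_of_one_le ?_ h1
      simpa using h2
  have hbd : ∀ z, ‖z‖ ≤ R → ‖G z‖ ≤ Real.exp M := by
    intro z hz
    refine Complex.norm_le_of_forall_mem_frontier_norm_le (U := ball (0 : ℂ) (2 * R))
      isBounded_ball hG.diffContOnCl (fun w hw ↦ ?_)
      (subset_closure (mem_ball_zero_iff.mpr (by linarith)))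
    rw [frontier_ball _ (by positivity), mem_sphere_zero_iff_norm] at hw
    have h1 := hK w
    have h2 := hlow w hw
    rw [hFG, norm_mul, hw] at h1
    have hexp : Real.exp M = K' * Real.exp (η / 32 * (2 * R)) := by
      rw [hM, Real.exp_add, Real.exp_log (by linarith)]; ring_nf
    rw [hexp]
    calc ‖G w‖ ≤ ‖aeval w (linProd s)‖ * ‖G w‖ := le_mul_of_one_le_left (norm_nonneg _) h2
      _ ≤ K * Real.exp (η / 32 * (2 * R)) := h1
      _ ≤ _ := by gcongr
  refine ⟨s, fun α hα ↦ (hs0 α hα).le, fun z hz ↦ ?_⟩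
  have h1 : ‖G z - 1‖ ≤ η := by
    refine (norm_sub_one_le_of_nonvanishing hG hG0 hR2 hM0 hne hbd ?_ hz).trans ?_
    · rw [div_le_one hR0]; nlinarith
    · rw [div_le_iff₀ hR0]; exact hMR
  have h2 : 1 / 2 ≤ ‖G z‖ := by
    have h3 := norm_sub_norm_le (1 : ℂ) (1 - G z)
    rw [norm_one, sub_sub_cancel, norm_sub_rev] at h3
    linarith
  have h3 := hB z (by simpa using hz)
  have h4 : ‖aeval z (linProd s)‖ ≤ 2 * B := by
    rw [hFG, norm_mul] at h3
    nlinarith [norm_nonneg (aeval z (linProd s))]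
  calc ‖aeval z (linProd s) - F z‖ = ‖aeval z (linProd s)‖ * ‖G z - 1‖ := by
        rw [hFG, ← norm_mul, ← norm_neg]; congr 1; ring
    _ ≤ 2 * B * (ε / (2 * B)) := by
        gcongr
        exact h1.trans (min_le_right _ _)
    _ = ε := by field_simp

/-- Coefficientwise version of `exists_linProd_approx`. -/
theorem exists_linProd_coeff_tendsto {a : ℕ → ℝ} {F : ℂ → ℂ}
    (hsum : ∀ z, HasSum (fun k ↦ (a k : ℂ) * z ^ k) (F z)) (h0 : F 0 = 1)
    (hzero : ∀ z, F z = 0 → ∃ x : ℝ, x < 0 ∧ z = x)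
    (hgrowth : ∀ δ : ℝ, 0 < δ → ∃ K : ℝ, ∀ z, ‖F z‖ ≤ K * Real.exp (δ * ‖z‖)) :
    ∃ (s : ℕ → Multiset ℝ) (B : ℝ), (∀ N, ∀ α ∈ s N, 0 ≤ α) ∧
      (∀ k, Tendsto (fun N ↦ (linProd (s N)).coeff k) atTop (𝓝 (a k))) ∧
      ∀ N, (linProd (s N)).eval 1 ≤ B := by
  choose s hs hsF using fun N : ℕ ↦ exists_linProd_approx (differentiable_of_hasSum hsum) h0 hzero
    hgrowth (Nat.one_div_pos_of_nat (α := ℝ) (n := N))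
  refine ⟨s, ‖F 1‖ + 1, hs, fun k ↦ ?_, fun N ↦ ?_⟩
  · rw [tendsto_iff_norm_sub_tendsto_zero]
    refine squeeze_zero (fun _ ↦ norm_nonneg _) (fun N ↦ ?_)
      (tendsto_one_div_add_atTop_nhds_zero_nat (𝕜 := ℝ))
    have hp : ∀ z : ℂ, HasSum (fun k ↦ ((linProd (s N)).coeff k : ℂ) * z ^ k)
        (aeval z (linProd (s N))) := by
      intro z
      rw [aeval_eq_sum_range]
      have : HasSum (fun k ↦ ((linProd (s N)).coeff k : ℂ) * z ^ k)
          (∑ k ∈ Finset.range ((linProd (s N)).natDegree + 1),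
            ((linProd (s N)).coeff k : ℂ) * z ^ k) :=
        hasSum_sum_of_ne_finset_zero fun k hk ↦ by
          rw [coeff_eq_zero_of_natDegree_lt (by simp at hk; omega)]; simp
      convert this using 1
      refine Finset.sum_congr rfl fun k _ ↦ ?_
      rw [Algebra.smul_def]; rfl
    have hd : ∀ z : ℂ, HasSum (fun k ↦ (((linProd (s N)).coeff k : ℂ) - a k) * z ^ k)
        (aeval z (linProd (s N)) - F z) := by
      intro z
      simpa only [sub_mul] using (hp z).sub (hsum z)
    have := norm_coeff_le_of_hasSum hd (fun z hz ↦ hsF N z hz.le) k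
    rw [← Complex.ofReal_sub, Complex.norm_real] at this
    exact this
  · have h1 := hsF N 1 (by simp)
    have h2 : aeval (1 : ℂ) (linProd (s N)) = (((linProd (s N)).eval 1 : ℝ) : ℂ) := by
      simpa using Polynomial.aeval_algebraMap_apply ℂ (1 : ℝ) (linProd (s N))
    have h3 : ‖aeval (1 : ℂ) (linProd (s N))‖ ≤ ‖F 1‖ + 1 := by
      have h4 := norm_sub_norm_le (aeval (1 : ℂ) (linProd (s N))) (F 1)
      have h5 : 1 / ((N : ℝ) + 1) ≤ 1 := by
        rw [div_le_one (by positivity)]; linarith [N.cast_nonneg (α := ℝ)]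
      linarith
    rw [h2, Complex.norm_real] at h3
    exact (le_abs_self _).trans h3

end Factorization

section Theta

open Topology MeasureTheory

/-- The theta-type series `∑_{m ≥ 1} m^{2k} exp(-π m² x)`. -/
noncomputable def thetaSum (k : ℕ) (x : ℝ) : ℝ :=
  ∑' n : ℕ, ((n : ℝ) + 1) ^ (2 * k) * Real.exp (-(Real.pi * ((n : ℝ) + 1) ^ 2 * x))

lemma summable_thetaSum (k : ℕ) {x : ℝ} (hx : 0 < x) :
    Summable fun n : ℕ ↦ ((n : ℝ) + 1) ^ (2 * k) * Real.exp (-(Real.pi * ((n : ℝ) + 1) ^ 2 * x)) := by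
  have h := (summable_nat_add_iff 1).mpr
    (Real.summable_pow_mul_exp_neg_nat_mul (2 * k) (mul_pos Real.pi_pos hx))
  refine Summable.of_nonneg_of_le (fun n ↦ by positivity) (fun n ↦ ?_) h
  push_cast
  gcongr
  have : 0 ≤ Real.pi * x * (((n : ℝ) + 1) ^ 2 - (n + 1)) := by
    have : ((n : ℝ) + 1) ^ 2 - (n + 1) = n * (n + 1) := by ring
    rw [this]; positivity
  linarith

lemma hasDerivAt_thetaSum (k : ℕ) {x : ℝ} (hx : 0 < x) :
    HasDerivAt (thetaSum k) (-Real.pi * thetaSum (k + 1) x) x := by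
  have hmem : x ∈ Set.Ioi (x / 2) := by simp [hx]
  have h := hasDerivAt_tsum_of_isPreconnected (𝕜 := ℝ) (t := Set.Ioi (x / 2))
    (g := fun (n : ℕ) y ↦
      ((n : ℝ) + 1) ^ (2 * k) * Real.exp (-(Real.pi * ((n : ℝ) + 1) ^ 2 * y)))
    (g' := fun (n : ℕ) y ↦
      -Real.pi * (((n : ℝ) + 1) ^ (2 * (k + 1)) * Real.exp (-(Real.pi * ((n : ℝ) + 1) ^ 2 * y))))
    ((summable_thetaSum (k + 1) (half_pos hx)).mul_left Real.pi) isOpen_Ioi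
    (convex_Ioi _).isPreconnected (fun n y _ ↦ ?_) (fun n y hy ↦ ?_) hmem
    (summable_thetaSum k hx) hmem
  · rw [tsum_mul_left] at h
    exact h
  · have h1 := (((hasDerivAt_id y).const_mul (Real.pi * ((n : ℝ) + 1) ^ 2)).neg.exp).const_mul
      (((n : ℝ) + 1) ^ (2 * k))
    refine h1.congr_deriv ?_
    simp only [id, Pi.neg_apply]
    ring
  · rw [Real.norm_eq_abs, abs_mul, abs_neg, abs_of_pos Real.pi_pos, abs_of_nonneg (by positivity)]
    have := (Set.mem_Ioi.mp hy).le
    gcongr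

lemma continuous_thetaSum_exp (k : ℕ) : Continuous fun t ↦ thetaSum k (Real.exp (4 * t)) :=
  continuous_iff_continuousAt.mpr fun t ↦
    (hasDerivAt_thetaSum k (Real.exp_pos (4 * t))).continuousAt.comp
      (f := fun t ↦ Real.exp (4 * t)) (by fun_prop)

lemma tsum_int_exp_eq_thetaSum {x : ℝ} (hx : 0 < x) :
    ∑' n : ℤ, Real.exp (-Real.pi * x * (n : ℝ) ^ 2) = 1 + 2 * thetaSum 0 x := by
  have hs := (summable_thetaSum 0 hx).hasSum
  have e1 : ∀ n : ℕ, ((n : ℝ) + 1) ^ (2 * 0) * Real.exp (-(Real.pi * ((n : ℝ) + 1) ^ 2 * x)) =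
      Real.exp (-Real.pi * x * (((n + 1 : ℕ) : ℤ) : ℝ) ^ 2) := by
    intro n; simp; ring
  have e2 : ∀ n : ℕ, ((n : ℝ) + 1) ^ (2 * 0) * Real.exp (-(Real.pi * ((n : ℝ) + 1) ^ 2 * x)) =
      Real.exp (-Real.pi * x * ((-((n : ℤ) + 1) : ℤ) : ℝ) ^ 2) := by
    intro n; push_cast; simp; ring
  have h1 := hs
  have h2 := hs
  simp only [e1] at h1
  simp only [e2] at h2
  have h3 := (hasSum_nat_add_iff (f := fun n : ℕ ↦
    Real.exp (-Real.pi * x * ((n : ℤ) : ℝ) ^ 2)) 1).mp h1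
  have h4 := (h3.of_nat_of_neg_add_one (f := fun n : ℤ ↦ Real.exp (-Real.pi * x * (n : ℝ) ^ 2))
    h2).tsum_eq
  rw [h4]
  simp only [← e1, ← e2]
  simp [thetaSum]
  ring

lemma one_add_two_mul_thetaSum {x : ℝ} (hx : 0 < x) :
    1 + 2 * thetaSum 0 x = 1 / x ^ (1 / 2 : ℝ) * (1 + 2 * thetaSum 0 x⁻¹) := by
  rw [← tsum_int_exp_eq_thetaSum hx, ← tsum_int_exp_eq_thetaSum (inv_pos.mpr hx),
    Real.tsum_exp_neg_mul_int_sq hx]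
  simp only [div_eq_mul_inv]

lemma PhiRC_eq (t : ℝ) : PhiRC t = 2 * Real.pi ^ 2 * Real.exp (9 * t) * thetaSum 2 (Real.exp (4 * t))
    - 3 * Real.pi * Real.exp (5 * t) * thetaSum 1 (Real.exp (4 * t)) := by
  rw [thetaSum, thetaSum, ← tsum_mul_left, ← tsum_mul_left, ← Summable.tsum_sub
    ((summable_thetaSum 2 (Real.exp_pos _)).mul_left _)
    ((summable_thetaSum 1 (Real.exp_pos _)).mul_left _), PhiRC]
  refine tsum_congr fun n ↦ ?_
  rw [show -((n : ℝ) + 1) ^ 2 * Real.pi * Real.exp (4 * t) =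
    -(Real.pi * ((n : ℝ) + 1) ^ 2 * Real.exp (4 * t)) by ring]
  ring

lemma continuous_PhiRC : Continuous PhiRC := by
  have h1 := continuous_thetaSum_exp 1
  have h2 := continuous_thetaSum_exp 2
  rw [show PhiRC = _ from funext PhiRC_eq]
  fun_prop

lemma PhiRC_neg (t : ℝ) : PhiRC (-t) = PhiRC t := by
  let S (k : ℕ) (t : ℝ) : ℝ := thetaSum k (Real.exp (4 * t))
  have hS : ∀ k t, HasDerivAt (S k) (-4 * Real.pi * Real.exp (4 * t) * S (k + 1) t) t := by
    intro k t
    have h1 := (hasDerivAt_thetaSum k (Real.exp_pos (4 * t))).comp t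
      ((hasDerivAt_id t).const_mul 4).exp
    refine h1.congr_deriv ?_
    simp only [S, id]
    ring
  have hE : ∀ (c : ℝ) t, HasDerivAt (fun t ↦ Real.exp (c * t)) (c * Real.exp (c * t)) t := by
    intro c t
    refine (((hasDerivAt_id t).const_mul c).exp).congr_deriv ?_
    simp only [id]
    ring
  have hadd : ∀ a b t : ℝ, Real.exp (a * t) * Real.exp (b * t) = Real.exp ((a + b) * t) := by
    intro a b t
    rw [← Real.exp_add, add_mul]
  let u (t : ℝ) : ℝ := Real.exp (1 * t) * (1 + 2 * S 0 t)
  let v (t : ℝ) : ℝ := u t - 8 * Real.pi * (Real.exp (5 * t) * S 1 t)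
  have hu : ∀ t, HasDerivAt u (v t) t := by
    intro t
    refine ((hE 1 t).mul (((hS 0 t).const_mul 2).const_add 1)).congr_deriv ?_
    have := hadd 1 4 t
    norm_num at this
    simp only [v, u]
    rw [← this]
    ring_nf
  have hv : ∀ t, HasDerivAt v (u t + 16 * PhiRC t) t := by
    intro t
    refine ((hu t).sub (((hE 5 t).mul (hS 1 t)).const_mul (8 * Real.pi))).congr_deriv ?_
    have := hadd 5 4 t
    norm_num at this
    rw [PhiRC_eq, ← this]
    simp only [v, S]
    ring
  have hueven : ∀ t, u (-t) = u t := by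
    intro t
    have h1 := one_add_two_mul_thetaSum (Real.exp_pos (4 * t))
    have h2 : Real.exp (4 * t) ^ (1 / 2 : ℝ) = Real.exp (1 * t) * Real.exp (1 * t) := by
      rw [← Real.exp_mul, ← Real.exp_add]; congr 1; ring
    have h3 : (Real.exp (4 * t))⁻¹ = Real.exp (4 * -t) := by rw [← Real.exp_neg]; congr 1; ring
    have h4 : Real.exp (1 * -t) = (Real.exp (1 * t))⁻¹ := by rw [← Real.exp_neg]; congr 1; ring
    simp only [u, S]
    rw [h1, h2, h3, h4]
    field_simp
  have hvodd : ∀ t, -v (-t) = v t := by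
    intro t
    have h1 : HasDerivAt (fun t ↦ u (-t)) (-v (-t)) t := by
      simpa [Function.comp_def] using (hu (-t)).comp t (hasDerivAt_neg t)
    rw [funext hueven] at h1
    exact h1.unique (hu t)
  have h1 : HasDerivAt (fun t ↦ -v (-t)) (u (-t) + 16 * PhiRC (-t)) t := by
    have := ((hv (-t)).comp t (hasDerivAt_neg t)).neg
    simp only [mul_neg, mul_one, neg_neg] at this
    exact this
  rw [funext hvodd] at h1
  have := h1.unique (hv t)
  rw [hueven] at this
  linarith

end Theta

section Mellin

open Topology MeasureTheory

lemma integral_exp_mul_exp_neg_exp {a b : ℝ} (ha : 0 < a) (hb : 0 < b) :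
    Integrable (fun t : ℝ ↦ Real.exp (a * t) * Real.exp (-(b * Real.exp (4 * t)))) ∧
    ∫ t : ℝ, Real.exp (a * t) * Real.exp (-(b * Real.exp (4 * t))) =
      Real.Gamma (a / 4) * b ^ (-(a / 4)) / 4 := by
  have hd : ∀ t ∈ (Set.univ : Set ℝ), HasDerivWithinAt (fun t ↦ Real.exp (4 * t))
      (4 * Real.exp (4 * t)) Set.univ t := fun t _ ↦ by
    refine ((((hasDerivAt_id t).const_mul 4).exp).congr_deriv ?_).hasDerivWithinAt
    simp only [id]
    ring
  have hinj : Set.InjOn (fun t : ℝ ↦ Real.exp (4 * t)) Set.univ := fun x _ y _ hxy ↦ by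
    have := Real.exp_injective hxy
    linarith
  have himg : Set.image (fun t : ℝ ↦ Real.exp (4 * t)) Set.univ = Set.Ioi 0 := by
    ext y
    simp only [Set.image_univ, Set.mem_range, Set.mem_Ioi]
    refine ⟨fun ⟨t, ht⟩ ↦ ht ▸ Real.exp_pos _, fun hy ↦ ⟨Real.log y / 4, ?_⟩⟩
    rw [mul_div_cancel₀ _ (by norm_num), Real.exp_log hy]
  have hfun : ∀ t : ℝ, |4 * Real.exp (4 * t)| •
      (Real.exp (4 * t) ^ (a / 4 - 1) * Real.exp (-(b * Real.exp (4 * t)))) =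
      4 * (Real.exp (a * t) * Real.exp (-(b * Real.exp (4 * t)))) := by
    intro t
    rw [abs_of_pos (by positivity), smul_eq_mul, ← Real.exp_mul, mul_assoc, ← mul_assoc (Real.exp _),
      ← Real.exp_add]
    congr 3
    ring_nf
  have h4 : 0 < a / 4 := by positivity
  have hval := integral_image_eq_integral_abs_deriv_smul MeasurableSet.univ hd hinj
    (fun x : ℝ ↦ x ^ (a / 4 - 1) * Real.exp (-(b * x)))
  have hiff := integrableOn_image_iff_integrableOn_abs_deriv_smul MeasurableSet.univ hd hinj
    (fun x : ℝ ↦ x ^ (a / 4 - 1) * Real.exp (-(b * x)))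
  simp only [himg, hfun] at hval hiff
  rw [Real.integral_rpow_mul_exp_neg_mul_Ioi h4 hb, Measure.restrict_univ, integral_const_mul] at hval
  constructor
  · have h5 : IntegrableOn (fun x : ℝ ↦ x ^ (a / 4 - 1) * Real.exp (-(b * x))) (Set.Ioi 0) := by
      by_contra hcon
      have := integral_undef hcon
      rw [Real.integral_rpow_mul_exp_neg_mul_Ioi h4 hb] at this
      have h6 : 0 < (1 / b) ^ (a / 4) * Real.Gamma (a / 4) :=
        mul_pos (by positivity) (Real.Gamma_pos_of_pos h4)
      linarith
    have h6 := (hiff.mp h5).const_mul 4⁻¹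
    rw [Measure.restrict_univ] at h6
    simpa using h6
  · rw [Real.rpow_neg hb.le]
    rw [one_div, Real.inv_rpow hb.le] at hval
    linarith

lemma integral_exp_mul_thetaSum (k : ℕ) {a : ℝ} (ha : 4 * k + 2 < a) :
    Integrable (fun t : ℝ ↦ Real.exp (a * t) * thetaSum k (Real.exp (4 * t))) ∧
    ∫ t : ℝ, Real.exp (a * t) * thetaSum k (Real.exp (4 * t)) =
      Real.Gamma (a / 4) * Real.pi ^ (-(a / 4)) / 4 *
        ∑' n : ℕ, ((n : ℝ) + 1) ^ (-(a / 2 - 2 * k)) := by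
  have ha0 : 0 < a := by linarith [k.cast_nonneg (α := ℝ)]
  let f (n : ℕ) (t : ℝ) : ℝ := ((n : ℝ) + 1) ^ (2 * k) *
    (Real.exp (a * t) * Real.exp (-(Real.pi * ((n : ℝ) + 1) ^ 2 * Real.exp (4 * t))))
  have hf : ∀ n, Integrable (f n) := fun n ↦
    (integral_exp_mul_exp_neg_exp ha0 (by positivity)).1.const_mul _
  have hfi : ∀ n, ∫ t, f n t =
      Real.Gamma (a / 4) * Real.pi ^ (-(a / 4)) / 4 * ((n : ℝ) + 1) ^ (-(a / 2 - 2 * k)) := by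
    intro n
    have hn : 0 < (n : ℝ) + 1 := by positivity
    rw [integral_const_mul, (integral_exp_mul_exp_neg_exp ha0 (by positivity)).2,
      Real.mul_rpow Real.pi_pos.le (by positivity), ← Real.rpow_natCast _ 2,
      ← Real.rpow_natCast _ (2 * k), ← Real.rpow_mul hn.le,
      show -(a / 2 - 2 * (k : ℝ)) = ((2 * k : ℕ) : ℝ) + (2 : ℕ) * (-(a / 4)) by push_cast; ring,
      Real.rpow_add hn]
    ring
  have hnorm : ∀ n, ∫ t, ‖f n t‖ = ∫ t, f n t := fun n ↦ by
    congr 1 with t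
    exact Real.norm_of_nonneg (by positivity)
  have hsum : Summable fun n : ℕ ↦ ((n : ℝ) + 1) ^ (-(a / 2 - 2 * k)) := by
    have := (summable_nat_add_iff 1).mpr
      (Real.summable_nat_rpow (p := -(a / 2 - 2 * k)).mpr (by linarith))
    exact_mod_cast this
  have hs : Summable fun n ↦ ∫ t, ‖f n t‖ := by
    simp only [hnorm, hfi]
    exact hsum.mul_left _
  have htsum : ∀ t, ∑' n, f n t = Real.exp (a * t) * thetaSum k (Real.exp (4 * t)) := by
    intro t
    rw [thetaSum, ← tsum_mul_left]
    exact tsum_congr fun n ↦ by simp only [f]; ring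
  have hHS := hasSum_integral_of_summable_integral_norm hf hs
  simp only [htsum, hfi] at hHS
  have hval : ∫ t : ℝ, Real.exp (a * t) * thetaSum k (Real.exp (4 * t)) =
      Real.Gamma (a / 4) * Real.pi ^ (-(a / 4)) / 4 *
        ∑' n : ℕ, ((n : ℝ) + 1) ^ (-(a / 2 - 2 * k)) := by
    rw [← tsum_mul_left]; exact hHS.tsum_eq.symm
  refine ⟨?_, hval⟩
  by_contra hcon
  rw [integral_undef hcon] at hval
  have h1 : 0 < Real.Gamma (a / 4) * Real.pi ^ (-(a / 4)) / 4 := by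
    have := Real.Gamma_pos_of_pos (show 0 < a / 4 by positivity)
    positivity
  have h2 : 0 < ∑' n : ℕ, ((n : ℝ) + 1) ^ (-(a / 2 - 2 * k)) :=
    hsum.tsum_pos (fun n ↦ by positivity) 0 (by positivity)
  exact (mul_pos h1 h2).ne hval

/-- The two-sided Laplace transform of `Φ` in terms of the completed zeta function. -/
lemma integral_PhiRC_mul_exp {w : ℝ} (hw : 1 < w) :
    Integrable (fun t ↦ PhiRC t * Real.exp (w * t)) ∧
    ((∫ t, PhiRC t * Real.exp (w * t) : ℝ) : ℂ) =
      ((1 + w) / 2 * ((1 + w) / 2 - 1) / 8 : ℂ) * completedRiemannZeta ((1 + w) / 2) := by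
  obtain ⟨i2, v2⟩ := integral_exp_mul_thetaSum 2 (a := 9 + w) (by norm_num; linarith)
  obtain ⟨i1, v1⟩ := integral_exp_mul_thetaSum 1 (a := 5 + w) (by norm_num; linarith)
  have hfun : (fun t ↦ PhiRC t * Real.exp (w * t)) = fun t ↦
      2 * Real.pi ^ 2 * (Real.exp ((9 + w) * t) * thetaSum 2 (Real.exp (4 * t))) -
      3 * Real.pi * (Real.exp ((5 + w) * t) * thetaSum 1 (Real.exp (4 * t))) := by
    ext t
    rw [PhiRC_eq, add_mul, add_mul, Real.exp_add, Real.exp_add]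
    ring
  rw [hfun]
  refine ⟨(i2.const_mul _).sub (i1.const_mul _), ?_⟩
  rw [integral_sub (i2.const_mul _) (i1.const_mul _), integral_const_mul, integral_const_mul, v1, v2]
  set x := (1 + w) / 4 with hx
  have hx0 : 0 < x := by rw [hx]; linarith
  have e2 : (9 + w) / 4 = x + 1 + 1 := by rw [hx]; ring
  have e1 : (5 + w) / 4 = x + 1 := by rw [hx]; ring
  have d2 : -((9 + w) / 2 - 2 * (2 : ℕ)) = -(2 * x) := by rw [hx]; push_cast; ring
  have d1 : -((5 + w) / 2 - 2 * (1 : ℕ)) = -(2 * x) := by rw [hx]; push_cast; ring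
  have p2 : Real.pi ^ (-(x + 1 + 1)) = Real.pi ^ (-x) / Real.pi ^ 2 := by
    rw [show -(x + 1 + 1) = -x - (2 : ℕ) by push_cast; ring, Real.rpow_sub Real.pi_pos,
      Real.rpow_natCast]
  have p1 : Real.pi ^ (-(x + 1)) = Real.pi ^ (-x) / Real.pi := by
    rw [show -(x + 1) = -x - 1 by ring, Real.rpow_sub Real.pi_pos, Real.rpow_one]
  have hzeta : completedRiemannZeta ((1 + w) / 2) =
      ((Real.pi ^ (-x) * Real.Gamma x * ∑' n : ℕ, ((n : ℝ) + 1) ^ (-(2 * x)) : ℝ) : ℂ) := by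
    have hs : ((1 + w) / 2 : ℂ) = ((2 * x : ℝ) : ℂ) := by rw [hx]; push_cast; ring
    have hre : 1 < ((2 * x : ℝ) : ℂ).re := by rw [Complex.ofReal_re, hx]; linarith
    have h1 := riemannZeta_def_of_ne_zero (s := ((2 * x : ℝ) : ℂ))
      (by exact_mod_cast (by positivity : (2 * x) ≠ 0))
    have hG := Complex.Gammaℝ_ne_zero_of_re_pos (s := ((2 * x : ℝ) : ℂ)) (by linarith)
    rw [eq_div_iff hG] at h1
    rw [hs, ← h1, zeta_eq_tsum_one_div_nat_add_one_cpow hre, Complex.Gammaℝ_def]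
    have h2 : ∀ n : ℕ, 1 / ((n : ℂ) + 1) ^ ((2 * x : ℝ) : ℂ) =
        ((((n : ℝ) + 1) ^ (-(2 * x)) : ℝ) : ℂ) := by
      intro n
      rw [Real.rpow_neg (by positivity), Complex.ofReal_inv, Complex.ofReal_cpow (by positivity)]
      simp
    simp only [h2]
    rw [← Complex.ofReal_tsum]
    push_cast
    rw [← Complex.Gamma_ofReal, Complex.ofReal_cpow Real.pi_pos.le]
    push_cast
    rw [show (2 * (x : ℂ)) / 2 = x by ring, show -(2 * (x : ℂ)) / 2 = -x by ring]
    ring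
  rw [hzeta, e1, e2, d1, d2, p1, p2, Real.Gamma_add_one (by positivity : x + 1 ≠ 0),
    Real.Gamma_add_one hx0.ne']
  rw [show ((1 + w) / 2 * ((1 + w) / 2 - 1) / 8 : ℂ) = ((2 * x * (2 * x - 1) / 8 : ℝ) : ℂ) by
    rw [hx]; push_cast; ring, ← Complex.ofReal_mul]
  congr 1
  field_simp
  ring

end Mellin

section Coefficients

open Topology MeasureTheory

lemma thetaSum_pos (k : ℕ) {x : ℝ} (hx : 0 < x) : 0 < thetaSum k x :=
  (summable_thetaSum k hx).tsum_pos (fun n ↦ by positivity) 0 (by positivity)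

lemma PhiRC_pos {t : ℝ} (ht : 0 ≤ t) : 0 < PhiRC t := by
  have hx : (1 : ℝ) ≤ Real.exp (4 * t) := Real.one_le_exp (by positivity)
  have hx0 := Real.exp_pos (4 * t)
  have h12 : thetaSum 1 (Real.exp (4 * t)) ≤ thetaSum 2 (Real.exp (4 * t)) := by
    refine (summable_thetaSum 1 hx0).tsum_le_tsum (fun n ↦ ?_) (summable_thetaSum 2 hx0)
    have : (1 : ℝ) ≤ (n : ℝ) + 1 := by linarith [n.cast_nonneg (α := ℝ)]
    gcongr
    norm_num
  have h1 := thetaSum_pos 1 hx0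
  have hπ := Real.pi_gt_three
  rw [PhiRC_eq, show (9 : ℝ) * t = 5 * t + 4 * t by ring, Real.exp_add]
  have h3 : 3 * thetaSum 1 (Real.exp (4 * t)) <
      2 * Real.pi * (Real.exp (4 * t) * thetaSum 2 (Real.exp (4 * t))) := by
    have : thetaSum 1 (Real.exp (4 * t)) ≤ Real.exp (4 * t) * thetaSum 2 (Real.exp (4 * t)) := by
      nlinarith
    nlinarith
  have := mul_lt_mul_of_pos_left h3 (mul_pos Real.pi_pos (Real.exp_pos (5 * t)))
  linarith

lemma PhiRC_le (A : ℝ) :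
    ∃ K : ℝ, 0 ≤ K ∧ ∀ t, 0 ≤ t → PhiRC t ≤ K * Real.exp (-A * t ^ 2 - t) := by
  have hS := thetaSum_pos 2 (x := 1 / 2) (by norm_num)
  refine ⟨2 * Real.pi ^ 2 * thetaSum 2 (1 / 2) * Real.exp (10 + (|A| + 10) ^ 3), by positivity,
    fun t ht ↦ ?_⟩
  have hx : (1 : ℝ) ≤ Real.exp (4 * t) := Real.one_le_exp (by positivity)
  have hx0 := Real.exp_pos (4 * t)
  have h1 : thetaSum 2 (Real.exp (4 * t)) ≤
      Real.exp (-(Real.pi / 2 * Real.exp (4 * t))) * thetaSum 2 (1 / 2) := by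
    rw [thetaSum, thetaSum, ← tsum_mul_left]
    refine (summable_thetaSum 2 hx0).tsum_le_tsum (fun n ↦ ?_)
      ((summable_thetaSum 2 (by norm_num)).mul_left _)
    rw [mul_left_comm, ← Real.exp_add]
    gcongr
    have h2 : (1 : ℝ) ≤ ((n : ℝ) + 1) ^ 2 := one_le_pow₀ (by linarith [n.cast_nonneg (α := ℝ)])
    have h3 : (((n : ℝ) + 1) ^ 2 + Real.exp (4 * t)) / 2 ≤ ((n : ℝ) + 1) ^ 2 * Real.exp (4 * t) := by
      nlinarith
    have := mul_le_mul_of_nonneg_left h3 Real.pi_pos.le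
    linarith
  have h2 : PhiRC t ≤ 2 * Real.pi ^ 2 * Real.exp (9 * t) * thetaSum 2 (Real.exp (4 * t)) := by
    have := thetaSum_pos 1 hx0
    rw [PhiRC_eq]
    exact sub_le_self _ (by positivity)
  refine h2.trans ((mul_le_mul_of_nonneg_left h1 (by positivity)).trans ?_)
  have h3 : 9 * t + -(Real.pi / 2 * Real.exp (4 * t)) ≤
      10 + (|A| + 10) ^ 3 + (-A * t ^ 2 - t) := by
    have h4 := Real.pow_div_factorial_le_exp (4 * t) (by positivity) 3
    have h5 : t ^ 3 ≤ Real.pi / 2 * Real.exp (4 * t) := by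
      have : (4 * t) ^ 3 / (Nat.factorial 3 : ℝ) = 32 / 3 * t ^ 3 := by
        norm_num [Nat.factorial]; ring
      rw [this] at h4
      have h6 : 0 ≤ t ^ 3 := by positivity
      nlinarith [Real.pi_gt_three]
    have h6 : (|A| + 10) * t ^ 2 ≤ t ^ 3 + (|A| + 10) ^ 3 := by
      have hM : 0 ≤ |A| + 10 := by positivity
      generalize |A| + 10 = M at hM
      rcases le_total t M with h | h
      · have : t ^ 2 ≤ M ^ 2 := by gcongr
        nlinarith [pow_nonneg ht 3]
      · nlinarith [pow_nonneg hM 3, sq_nonneg t]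
    have h7 : A * t ^ 2 ≤ |A| * t ^ 2 := by gcongr; exact le_abs_self A
    nlinarith [sq_nonneg (t - 1)]
  calc _ = 2 * Real.pi ^ 2 * thetaSum 2 (1 / 2) *
        Real.exp (9 * t + -(Real.pi / 2 * Real.exp (4 * t))) := by rw [Real.exp_add]; ring
    _ ≤ 2 * Real.pi ^ 2 * thetaSum 2 (1 / 2) *
        Real.exp (10 + (|A| + 10) ^ 3 + (-A * t ^ 2 - t)) := by gcongr
    _ = _ := by rw [Real.exp_add]; ring

lemma integrableOn_exp_mul_PhiRC (A : ℝ) :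
    IntegrableOn (fun t ↦ Real.exp (A * t ^ 2) * PhiRC t) (Set.Ioi 0) := by
  obtain ⟨K, hK, hle⟩ := PhiRC_le A
  refine Integrable.mono' ((exp_neg_integrableOn_Ioi 0 one_pos).const_mul K)
    (by have := continuous_PhiRC; exact (by fun_prop : Continuous _).aestronglyMeasurable) ?_
  filter_upwards [ae_restrict_mem measurableSet_Ioi] with t ht
  have ht := (Set.mem_Ioi.mp ht).le
  have h0 := PhiRC_pos ht
  rw [Real.norm_of_nonneg (by positivity)]
  calc _ ≤ Real.exp (A * t ^ 2) * (K * Real.exp (-A * t ^ 2 - t)) := by gcongr; exact hle t ht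
    _ = K * Real.exp (A * t ^ 2 + (-A * t ^ 2 - t)) := by rw [Real.exp_add]; ring
    _ = _ := by congr 2; ring

lemma integrableOn_pow_mul_PhiRC (n : ℕ) :
    IntegrableOn (fun t ↦ t ^ (2 * n) * PhiRC t) (Set.Ioi 0) := by
  refine Integrable.mono' ((integrableOn_exp_mul_PhiRC 1).const_mul (n.factorial : ℝ))
    (by have := continuous_PhiRC; exact (by fun_prop : Continuous _).aestronglyMeasurable) ?_
  filter_upwards [ae_restrict_mem measurableSet_Ioi] with t ht
  have ht := (Set.mem_Ioi.mp ht).le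
  have h0 := PhiRC_pos ht
  rw [Real.norm_of_nonneg (by positivity), ← mul_assoc]
  gcongr
  have := Real.pow_div_factorial_le_exp (1 * t ^ 2) (by positivity) n
  rw [div_le_iff₀ (by positivity)] at this
  rw [pow_mul]
  simp only [one_mul] at this ⊢
  linarith

lemma bhat_nonneg (n : ℕ) : 0 ≤ bhat n :=
  setIntegral_nonneg measurableSet_Ioi fun t ht ↦ by
    have := PhiRC_pos (Set.mem_Ioi.mp ht).le
    have := (Set.mem_Ioi.mp ht).le
    positivity

lemma bhat_zero_pos : 0 < bhat 0 := by
  rw [bhat, setIntegral_pos_iff_support_of_nonneg_ae _ (integrableOn_pow_mul_PhiRC 0)]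
  · have : Set.Ioi (0 : ℝ) ⊆ (Function.support fun t : ℝ ↦ t ^ (2 * 0) * PhiRC t) ∩ Set.Ioi 0 :=
      fun t ht ↦ ⟨by simpa using (PhiRC_pos (Set.mem_Ioi.mp ht).le).ne', ht⟩
    exact lt_of_lt_of_le (by simp) (measure_mono this)
  · filter_upwards [ae_restrict_mem measurableSet_Ioi] with t ht
    simpa using (PhiRC_pos (Set.mem_Ioi.mp ht).le).le

lemma bhat_div_factorial_le {δ : ℝ} (hδ : 0 < δ) :
    ∃ K : ℝ, ∀ n, bhat n / (2 * n).factorial ≤ K * (δ ^ n / n.factorial) := by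
  refine ⟨∫ t in Set.Ioi 0, Real.exp (δ⁻¹ * t ^ 2) * PhiRC t, fun n ↦ ?_⟩
  rw [bhat, ← integral_div, ← integral_mul_const]
  refine setIntegral_mono_on ((integrableOn_pow_mul_PhiRC n).div_const _)
    ((integrableOn_exp_mul_PhiRC _).mul_const _) measurableSet_Ioi fun t ht ↦ ?_
  have ht := (Set.mem_Ioi.mp ht).le
  have h0 := PhiRC_pos ht
  have h1 := Real.pow_div_factorial_le_exp (δ⁻¹ * t ^ 2) (by positivity) n
  have h2 : ((n.factorial : ℝ)) * n.factorial ≤ (2 * n).factorial := by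
    have := Nat.factorial_mul_factorial_dvd_factorial_add n n
    rw [two_mul]
    exact_mod_cast Nat.le_of_dvd (Nat.factorial_pos _) this
  calc t ^ (2 * n) * PhiRC t / (2 * n).factorial
      ≤ t ^ (2 * n) * PhiRC t / (n.factorial * n.factorial) := by gcongr
    _ = (δ⁻¹ * t ^ 2) ^ n / n.factorial * PhiRC t * (δ ^ n / n.factorial) := by
      rw [mul_pow, inv_pow, pow_mul]
      field_simp
    _ ≤ _ := by gcongr

lemma norm_bhat_term_le {δ K : ℝ} (hK : ∀ n, bhat n / (2 * n).factorial ≤ K * (δ ^ n / n.factorial))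
    (z : ℂ) (n : ℕ) : ‖((bhat n / (2 * n).factorial : ℝ) : ℂ) * z ^ n‖ ≤
      K * ((δ * ‖z‖) ^ n / n.factorial) := by
  have h0 := bhat_nonneg n
  rw [norm_mul, norm_pow, Complex.norm_real, Real.norm_of_nonneg (by positivity), mul_pow]
  calc _ ≤ K * (δ ^ n / n.factorial) * ‖z‖ ^ n := by gcongr; exact hK n
    _ = _ := by ring

/-- The generating function `∑ b̂_n z^n / (2n)!`. -/
noncomputable def bhatSeries (z : ℂ) : ℂ := ∑' n : ℕ, ((bhat n / (2 * n).factorial : ℝ) : ℂ) * z ^ n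

lemma hasSum_bhatSeries (z : ℂ) :
    HasSum (fun n : ℕ ↦ ((bhat n / (2 * n).factorial : ℝ) : ℂ) * z ^ n) (bhatSeries z) := by
  obtain ⟨K, hK⟩ := bhat_div_factorial_le one_pos
  exact (Summable.of_norm_bounded ((Real.summable_pow_div_factorial (1 * ‖z‖)).mul_left K)
    (norm_bhat_term_le hK z)).hasSum

lemma norm_bhatSeries_le {δ : ℝ} (hδ : 0 < δ) :
    ∃ K : ℝ, ∀ z, ‖bhatSeries z‖ ≤ K * Real.exp (δ * ‖z‖) := by
  obtain ⟨K, hK⟩ := bhat_div_factorial_le hδ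
  refine ⟨K, fun z ↦ tsum_of_norm_bounded (HasSum.mul_left K ?_) (norm_bhat_term_le hK z)⟩
  rw [Real.exp_eq_exp_ℝ]
  exact NormedSpace.expSeries_div_hasSum_exp (δ * ‖z‖)

lemma bhatSeries_zero : bhatSeries 0 = bhat 0 := by
  rw [bhatSeries, tsum_eq_single 0 (fun n hn ↦ by simp [hn])]
  simp

lemma bhatSeries_sq_eq_integral_cosh (w : ℝ) :
    bhatSeries ((w : ℂ) ^ 2) = ((∫ t in Set.Ioi 0, Real.cosh (w * t) * PhiRC t : ℝ) : ℂ) := by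
  let f (n : ℕ) (t : ℝ) : ℝ := w ^ (2 * n) / (2 * n).factorial * (t ^ (2 * n) * PhiRC t)
  have hfi : ∀ n, ∫ t in Set.Ioi 0, f n t = bhat n / (2 * n).factorial * (w ^ 2) ^ n := by
    intro n
    rw [integral_const_mul, ← bhat, pow_mul]
    ring
  have hnorm : ∀ n, ∫ t in Set.Ioi 0, ‖f n t‖ = ∫ t in Set.Ioi 0, f n t := fun n ↦ by
    refine setIntegral_congr_fun measurableSet_Ioi fun t ht ↦ ?_
    have := PhiRC_pos (Set.mem_Ioi.mp ht).le
    have := (Set.mem_Ioi.mp ht).le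
    simp only [f, pow_mul w]
    exact Real.norm_of_nonneg (by positivity)
  have hs : HasSum (fun n ↦ bhat n / (2 * n).factorial * (w ^ 2) ^ n)
      (bhatSeries ((w : ℂ) ^ 2)).re := by
    have := Complex.hasSum_re (hasSum_bhatSeries ((w : ℂ) ^ 2))
    convert this using 2 with n
    rw [← Complex.ofReal_pow, ← Complex.ofReal_pow, ← Complex.ofReal_mul, Complex.ofReal_re]
  have hHS := hasSum_integral_of_summable_integral_norm (F := f)
    (μ := volume.restrict (Set.Ioi 0))
    (fun n ↦ (integrableOn_pow_mul_PhiRC n).const_mul _) (by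
      simp only [hnorm, hfi]; exact hs.summable)
  have hcosh : ∀ t, ∑' n, f n t = Real.cosh (w * t) * PhiRC t := fun t ↦ by
    rw [← ((Real.hasSum_cosh (w * t)).mul_right (PhiRC t)).tsum_eq]
    exact tsum_congr fun n ↦ by simp only [f, mul_pow]; ring
  simp only [hcosh, hfi] at hHS
  have := Complex.hasSum_ofReal.mpr hHS
  push_cast at this
  refine HasSum.unique ?_ this
  simpa using hasSum_bhatSeries ((w : ℂ) ^ 2)

lemma integral_PhiRC_mul_exp_eq_cosh {w : ℝ} (h : Integrable fun t ↦ PhiRC t * Real.exp (w * t)) :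
    ∫ t, PhiRC t * Real.exp (w * t) = 2 * ∫ t in Set.Ioi 0, Real.cosh (w * t) * PhiRC t := by
  have hneg : ∀ t, PhiRC (-t) * Real.exp (w * -t) = PhiRC t * Real.exp (-(w * t)) := fun t ↦ by
    rw [PhiRC_neg, mul_neg]
  have h1 : Integrable fun t ↦ PhiRC t * Real.exp (-(w * t)) := by
    simpa only [hneg] using h.comp_neg
  have h2 : ∫ t in Set.Iic 0, PhiRC t * Real.exp (w * t) =
      ∫ t in Set.Ioi 0, PhiRC t * Real.exp (-(w * t)) := by
    have := integral_comp_neg_Ioi 0 (fun t ↦ PhiRC t * Real.exp (w * t))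
    simp only [hneg, neg_zero] at this
    exact this.symm
  rw [← integral_add_compl measurableSet_Ioi h (s := Set.Ioi 0), Set.compl_Ioi, h2,
    ← integral_add h.integrableOn h1.integrableOn, ← integral_const_mul]
  congr 1 with t
  rw [Real.cosh_eq]
  ring

end Coefficients

section RiemannXi

open Topology

lemma differentiable_bhatSeries : Differentiable ℂ bhatSeries :=
  differentiable_of_hasSum hasSum_bhatSeries

/-- The generating function `∑ b̂_n z^n / (2n)!` at `z = w²` is, up to normalisation, Riemann's `ξ`. -/
lemma bhatSeries_sq (w : ℂ) : bhatSeries (w ^ 2) =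
    ((1 + w) / 2 * ((1 + w) / 2 - 1) * completedRiemannZeta₀ ((1 + w) / 2) + 1) / 16 := by
  have hs : Differentiable ℂ fun w : ℂ ↦ (1 + w) / 2 := by fun_prop
  have h1 : Differentiable ℂ fun w : ℂ ↦ bhatSeries (w ^ 2) :=
    differentiable_bhatSeries.comp (differentiable_id.pow 2)
  have h2 : Differentiable ℂ fun w : ℂ ↦
      ((1 + w) / 2 * ((1 + w) / 2 - 1) * completedRiemannZeta₀ ((1 + w) / 2) + 1) / 16 :=
    (((hs.mul (hs.sub_const 1)).mul (differentiable_completedZeta₀.comp hs)).add_const 1).div_const 16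
  refine congr_fun (AnalyticOnNhd.eq_of_frequently_eq (z₀ := 2)
    (fun z _ ↦ h1.analyticAt z) (fun z _ ↦ h2.analyticAt z) ?_) w
  have hray : ∀ x : ℝ, 1 < x → bhatSeries ((x : ℂ) ^ 2) =
      ((1 + x) / 2 * ((1 + x) / 2 - 1) * completedRiemannZeta₀ ((1 + x) / 2) + 1) / 16 := by
    intro x hx
    obtain ⟨hi, hv⟩ := integral_PhiRC_mul_exp hx
    rw [integral_PhiRC_mul_exp_eq_cosh hi, completedRiemannZeta_eq] at hv
    push_cast at hv
    rw [bhatSeries_sq_eq_integral_cosh]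
    have n1 : ((1 + x) / 2 : ℂ) ≠ 0 := by
      exact_mod_cast (by linarith : ((1 + x) / 2) ≠ 0)
    have n2 : (1 - (1 + x) / 2 : ℂ) ≠ 0 := by
      exact_mod_cast (by linarith : (1 - (1 + x) / 2) ≠ 0)
    generalize ((1 + x) / 2 : ℂ) = s at hv n1 n2 ⊢
    have key : s * (s - 1) * (completedRiemannZeta₀ s - 1 / s - 1 / (1 - s)) =
        s * (s - 1) * completedRiemannZeta₀ s + 1 := by
      field_simp
      ring
    linear_combination hv / 2 + key / 16
  have ht : Tendsto (fun n : ℕ ↦ ((2 + 1 / ((n : ℝ) + 1) : ℝ) : ℂ)) atTop (𝓝[≠] 2) := by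
    refine tendsto_nhdsWithin_iff.mpr ⟨?_, .of_forall fun n ↦ ?_⟩
    · have := (tendsto_one_div_add_atTop_nhds_zero_nat (𝕜 := ℝ)).const_add 2
      rw [add_zero] at this
      exact_mod_cast (Complex.continuous_ofReal.tendsto _).comp this
    · have : (2 + 1 / ((n : ℝ) + 1)) ≠ 2 := by
        have : 0 < 1 / ((n : ℝ) + 1) := by positivity
        linarith
      rw [Set.mem_compl_singleton_iff]
      exact_mod_cast this
  refine ht.frequently (Frequently.of_forall fun n ↦ hray _ ?_)
  have : 0 < 1 / ((n : ℝ) + 1) := by positivity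
  linarith

lemma bhatSeries_eq_zero (hRH : RiemannHypothesis) {z : ℂ} (hz : bhatSeries z = 0) :
    ∃ x : ℝ, x < 0 ∧ z = x := by
  obtain ⟨w, rfl⟩ := IsAlgClosed.exists_pow_nat_eq z two_pos
  set s : ℂ := (1 + w) / 2 with hs
  have h0 : bhatSeries (w ^ 2) = (s * (s - 1) * completedRiemannZeta₀ s + 1) / 16 := bhatSeries_sq w
  rw [hz] at h0
  have h1 : s * (s - 1) * completedRiemannZeta₀ s + 1 = 0 := by linear_combination -16 * h0
  have hs0 : s ≠ 0 := by rintro h; rw [h] at h1; simp at h1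
  have hs1 : s ≠ 1 := by rintro h; rw [h] at h1; simp at h1
  have hs1' : 1 - s ≠ 0 := sub_ne_zero.mpr hs1.symm
  have hΛ : completedRiemannZeta s = 0 := by
    rw [completedRiemannZeta_eq]
    field_simp
    linear_combination -h1
  have hζ : riemannZeta s = 0 := by rw [riemannZeta_def_of_ne_zero hs0, hΛ, zero_div]
  have hre : s.re = 1 / 2 := by
    refine hRH s hζ ?_ hs1
    rintro ⟨n, hn⟩
    have h2 : 1 ≤ (1 - s).re := by
      rw [hn]; simp; positivity
    have h3 := riemannZeta_ne_zero_of_one_le_re h2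
    rw [riemannZeta_def_of_ne_zero hs1', completedRiemannZeta_one_sub, hΛ, zero_div] at h3
    exact h3 rfl
  have hw : w.re = 0 := by
    have : w = 2 * s - 1 := by rw [hs]; ring
    rw [this]; simp [hre]
  have hw2 : w ^ 2 = ((-(w.im ^ 2) : ℝ) : ℂ) := by
    apply Complex.ext <;> simp [pow_two, hw]
  refine ⟨-(w.im ^ 2), ?_, hw2⟩
  have : w.im ≠ 0 := by
    intro h
    have : w = 0 := Complex.ext hw h
    rw [this, zero_pow two_ne_zero, bhatSeries_zero] at hz
    exact bhat_zero_pos.ne' (by exact_mod_cast hz)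
  have := pow_pos (abs_pos.mpr this) 2
  rw [sq_abs] at this
  linarith

end RiemannXi

/-- if the Riemann Hypothesis holds, then for every `q ∈ (0,1)`
the power series `∑ C_n^∞(q)·(n! b̂_n/(2n)!)·z^n` defines an entire function in
`𝓝̄_∞(q)`, i.e. of the form `c·z^m·∏_j (1 - z/x_j)` with all zeros `x_j` real,
`≤ 0`, logarithmically q-separated and bounded away from `0`; in particular the
sequence `{n! b̂_n/(2n)!}` is log-concave. -/
theorem stmt19 :
    RiemannHypothesis →
    (∀ q : ℝ, 0 < q → q < 1 →
      ∃ (f : ℂ → ℂ) (c : ℝ) (m : ℕ) (N : WithTop ℕ) (x : ℕ → ℝ),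
        (∀ z : ℂ, HasSum (fun k : ℕ =>
          ((qBinomInf q k * ((Nat.factorial k : ℝ) * bhat k /
            (Nat.factorial (2 * k) : ℝ)) : ℝ) : ℂ) * z ^ k) (f z)) ∧
        (∀ z : ℂ, Multipliable
          (fun j : {j : ℕ // (j : WithTop ℕ) < N} => 1 - z / ((x j : ℝ) : ℂ))) ∧
        (∀ z : ℂ, f z = ((c : ℝ) : ℂ) * z ^ m *
          ∏' j : {j : ℕ // (j : WithTop ℕ) < N}, (1 - z / ((x j : ℝ) : ℂ))) ∧
        (∀ j : ℕ, (j : WithTop ℕ) < N → x j ≤ 0) ∧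
        (∀ j l : ℕ, (j : WithTop ℕ) < N → (l : WithTop ℕ) < N → j ≠ l →
          ((x l ≤ x j ∧ x j < 0) ∨ (0 < x j ∧ x j ≤ x l)) → x j / x l ≤ q) ∧
        (∃ ε : ℝ, 0 < ε ∧ ∀ j : ℕ, (j : WithTop ℕ) < N → ε ≤ |x j|)) ∧
    (∀ n : ℕ, 1 ≤ n →
      ((Nat.factorial (n - 1) : ℝ) * bhat (n - 1) / (Nat.factorial (2 * n - 2) : ℝ)) *
        ((Nat.factorial (n + 1) : ℝ) * bhat (n + 1) / (Nat.factorial (2 * n + 2) : ℝ)) ≤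
      ((Nat.factorial n : ℝ) * bhat n / (Nat.factorial (2 * n) : ℝ)) ^ 2) := by
  intro hRH
  have h0 : (bhat 0 : ℂ) ≠ 0 := by exact_mod_cast bhat_zero_pos.ne'
  obtain ⟨s, B, hs, hlim, hB⟩ := exists_linProd_coeff_tendsto
    (a := fun k ↦ bhat k / ((2 * k).factorial * bhat 0)) (F := fun z ↦ bhatSeries z / bhat 0)
    (fun z ↦ by
      have e : ∀ k, ((bhat k / ((2 * k).factorial * bhat 0) : ℝ) : ℂ) * z ^ k =
          ((bhat k / (2 * k).factorial : ℝ) : ℂ) * z ^ k / bhat 0 := by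
        intro k
        rw [← div_div]
        push_cast
        ring
      simp only [e]
      exact (hasSum_bhatSeries z).div_const _)
    (by rw [bhatSeries_zero, div_self h0])
    (fun z hz ↦ bhatSeries_eq_zero hRH ((div_eq_zero_iff.mp hz).resolve_right h0))
    (fun δ hδ ↦ by
      obtain ⟨K, hK⟩ := norm_bhatSeries_le hδ
      refine ⟨K / bhat 0, fun z ↦ ?_⟩
      rw [norm_div, Complex.norm_real, Real.norm_of_nonneg bhat_zero_pos.le, div_mul_eq_mul_div]
      exact div_le_div_of_nonneg_right (hK z) bhat_zero_pos.le)
  exact separated_and_logConcave_of_approx bhat_zero_pos hs hlim hB
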